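/- arXiv:1406.6335 — 2 statements merged into one kernel-verified Lean document; each statement's English description precedes it below -/
import Mathlib

section
/- Let E be a Riesz space with point separating order dual that has a topologically full center, and let T be an order bounded linear operator on E. Then T commutes with every operator in Z(E) if and only if T is an orthomorphism of E. In particular, the commutant of Z(E) in the order bounded operators L_b(E) is Orth(E). -/
noncomputable section

open Set

/-- A map between preordered sets is *order bounded* if it maps order intervals into
order intervals. -/
def IsOrdBdd {E F : Type*} [Preorder E] [Preorder F] (f : E → F) : Prop :=
  ∀ a b : E, ∃ c d : F, ∀ x : E, a ≤ x → x ≤ b → c ≤ f x ∧ f x ≤ d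

/-- A map of a Riesz space is *band preserving* if it preserves disjointness. -/
def IsBandPres {E : Type*} [Lattice E] [AddCommGroup E] (T : E → E) : Prop :=
  ∀ x y : E, |x| ⊓ |y| = 0 → |T x| ⊓ |y| = 0

/-- An *orthomorphism*: an order bounded, band preserving linear map. -/
def IsOrtho {E : Type*} [Lattice E] [AddCommGroup E] [Module ℝ E] (T : E → E) : Prop :=
  IsLinearMap ℝ T ∧ IsOrdBdd T ∧ IsBandPres T

/-- A member of the *ideal center* `Z(E)`: an orthomorphism dominated by a multiple of the
identity. -/
def IsCentral {E : Type*} [Lattice E] [AddCommGroup E] [Module ℝ E] (T : E → E) : Prop :=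
  IsOrtho T ∧ ∃ c : ℝ, ∀ x : E, 0 ≤ x → -(c • x) ≤ T x ∧ T x ≤ c • x

/-- Order continuity of a real functional: it converges to `0` along every downward
directed system with infimum `0`. -/
def IsOrderContinuousFun {X : Type*} [Lattice X] [AddCommGroup X] (φ : X → ℝ) : Prop :=
  ∀ s : Set X, s.Nonempty → DirectedOn (· ≥ ·) s → IsGLB s 0 →
    ∀ ε : ℝ, 0 < ε → ∃ x ∈ s, ∀ y ∈ s, y ≤ x → |φ y| < ε

/-- `p` realizes the Riesz space `D` as the order dual `E^∼` of `E`. -/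
structure IsOrderDual (E D : Type*) [Lattice E] [AddCommGroup E] [Module ℝ E]
    [Lattice D] [AddCommGroup D] [Module ℝ D] (p : D → E → ℝ) : Prop where
  lin_fun : ∀ f : D, IsLinearMap ℝ (p f)
  lin_vec : ∀ x : E, IsLinearMap ℝ fun f => p f x
  bdd : ∀ f : D, IsOrdBdd (p f)
  inj : ∀ f g : D, (∀ x, p f x = p g x) → f = g
  surj : ∀ φ : E → ℝ, IsLinearMap ℝ φ → IsOrdBdd φ → ∃ f : D, ∀ x, p f x = φ x
  le_iff : ∀ f g : D, f ≤ g ↔ ∀ x : E, 0 ≤ x → p f x ≤ p g x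

/-- `p` realizes the Riesz space `B` as the order continuous order dual `(X^∼)ₙ` of `X`
(used for `X = A^∼`, giving `B = (A^∼)ₙ^∼`). -/
structure IsOrderContinuousDual (X B : Type*) [Lattice X] [AddCommGroup X] [Module ℝ X]
    [Lattice B] [AddCommGroup B] [Module ℝ B] (p : B → X → ℝ) : Prop where
  lin_fun : ∀ F : B, IsLinearMap ℝ (p F)
  lin_vec : ∀ f : X, IsLinearMap ℝ fun F => p F f
  bdd : ∀ F : B, IsOrdBdd (p F)
  cont : ∀ F : B, IsOrderContinuousFun (p F)
  inj : ∀ F G : B, (∀ f, p F f = p G f) → F = G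
  surj : ∀ φ : X → ℝ, IsLinearMap ℝ φ → IsOrdBdd φ → IsOrderContinuousFun φ →
    ∃ F : B, ∀ f, p F f = φ f
  le_iff : ∀ F G : B, F ≤ G ↔ ∀ f : X, 0 ≤ f → p F f ≤ p G f

/-- `ρ` realizes the lattice-ordered algebra `O` as the `f`-algebra `Orth(E)` of all
orthomorphisms of `E`. -/
structure IsOrthAlg (E O : Type*) [Lattice E] [AddCommGroup E] [Module ℝ E]
    [Lattice O] [Ring O] [Module ℝ O] (ρ : O → E → E) : Prop where
  ortho : ∀ a : O, IsOrtho (ρ a)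
  lin_vec : ∀ x : E, IsLinearMap ℝ fun a => ρ a x
  map_one : ∀ x : E, ρ 1 x = x
  map_mul : ∀ (a b : O) (x : E), ρ (a * b) x = ρ a (ρ b x)
  inj : ∀ a b : O, (∀ x, ρ a x = ρ b x) → a = b
  surj : ∀ T : E → E, IsOrtho T → ∃ a : O, ∀ x, ρ a x = T x
  le_iff : ∀ a b : O, a ≤ b ↔ ∀ x : E, 0 ≤ x → ρ a x ≤ ρ b x

/-- `ρ` realizes the normed lattice-ordered algebra `Z` as the ideal center `Z(E)` of `E`,
an AM-space whose norm is the order unit norm (the order/algebra unit being `id`). -/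
structure IsCenterOf (E Z : Type*) [Lattice E] [AddCommGroup E] [Module ℝ E]
    [Lattice Z] [NormedRing Z] [NormedAlgebra ℝ Z] (ρ : Z → E → E) : Prop where
  central : ∀ a : Z, IsCentral (ρ a)
  lin_vec : ∀ x : E, IsLinearMap ℝ fun a => ρ a x
  map_one : ∀ x : E, ρ 1 x = x
  map_mul : ∀ (a b : Z) (x : E), ρ (a * b) x = ρ a (ρ b x)
  inj : ∀ a b : Z, (∀ x, ρ a x = ρ b x) → a = b
  surj : ∀ T : E → E, IsCentral T → ∃ a : Z, ∀ x, ρ a x = T x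
  le_iff : ∀ a b : Z, a ≤ b ↔ ∀ x : E, 0 ≤ x → ρ a x ≤ ρ b x
  norm_le_iff : ∀ (a : Z) (c : ℝ), 0 ≤ c →
    (‖a‖ ≤ c ↔ ∀ x : E, 0 ≤ x → -(c • x) ≤ ρ a x ∧ ρ a x ≤ c • x)

/-- The pairing `p : D → E → ℝ` separates the points of `E`. -/
def SepPoints {E D : Type*} [Zero E] (p : D → E → ℝ) : Prop :=
  ∀ x : E, (∀ f : D, p f x = 0) → x = 0

/-- `y` belongs to the `σ(E,D)`-closure of `s ⊆ E`, for the pairing `p : D → E → ℝ`. -/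
def InWeakClosure {E D : Type*} (p : D → E → ℝ) (s : Set E) (y : E) : Prop :=
  ∀ (fs : Finset D) (ε : ℝ), 0 < ε → ∃ z ∈ s, ∀ f ∈ fs, |p f z - p f y| < ε

/-- `E` has a *topologically full center*: for each `x ∈ E₊` the `σ(E,E^∼)`-closure of
`Z(E)x` contains the order ideal generated by `x`.  Here `p : D → E → ℝ` is the duality
with `E^∼` and `ρ : Z → E → E` is the action of the ideal center. -/
def TopFullCenter {E D Z : Type*} [Lattice E] [AddCommGroup E] [Module ℝ E]
    (p : D → E → ℝ) (ρ : Z → E → E) : Prop :=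
  ∀ x : E, 0 ≤ x → ∀ y : E, (∃ c : ℝ, 0 ≤ c ∧ |y| ≤ c • x) →
    InWeakClosure p {z | ∃ T : Z, ρ T x = z} y

/-- `FG` is the Arens product `F ⬝ G` in the order bidual `B` of the algebra `A`:
`(F⬝G)(f) = F(G⬝f)`, `(G⬝f)(a) = G(f⬝a)`, `(f⬝a)(b) = f(ab)`; `pA : DA → A → ℝ` is the
duality of `A` with `A^∼` and `pB : B → DA → ℝ` that of `(A^∼)ₙ^∼` with `A^∼`. -/
def IsArensProduct {A DA B : Type*} [Mul A] (pA : DA → A → ℝ) (pB : B → DA → ℝ)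
    (F G FG : B) : Prop :=
  ∀ f Gf : DA,
    (∀ (a : A) (fa : DA), (∀ b : A, pA fa b = pA f (a * b)) → pA Gf a = pB G fa) →
    pB FG f = pB F Gf

/-- The ring structure of `B` is the Arens multiplication inherited from `A`, with unit the
canonical image of `1 ∈ A`. -/
structure IsArensAlgebra {A DA B : Type*} [Monoid A] [Ring B]
    (pA : DA → A → ℝ) (pB : B → DA → ℝ) : Prop where
  mul_def : ∀ F G : B, IsArensProduct pA pB F G (F * G)
  one_def : ∀ f : DA, pB 1 f = pA f 1

section NormedArens

variable (Z : Type*) [NormedRing Z] [NormedAlgebra ℝ Z]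

/-- First step of the Arens construction: `f ⬝ a` for `f ∈ Z'`, `a ∈ Z`:
`(f⬝a)(b) = f(ab)`. -/
def arensDot (f : Z →L[ℝ] ℝ) (a : Z) : Z →L[ℝ] ℝ :=
  f.comp (ContinuousLinearMap.mul ℝ Z a)

/-- `a ↦ f ⬝ a` as a continuous linear map. -/
def arensDotL (f : Z →L[ℝ] ℝ) : Z →L[ℝ] Z →L[ℝ] ℝ :=
  (ContinuousLinearMap.compL ℝ Z Z ℝ f).comp (ContinuousLinearMap.mul ℝ Z)

/-- Second step of the Arens construction: `F ⬝ f` for `F ∈ Z''`, `f ∈ Z'`: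
`(F⬝f)(a) = F(f⬝a)`. -/
def arensFDot (F : (Z →L[ℝ] ℝ) →L[ℝ] ℝ) (f : Z →L[ℝ] ℝ) : Z →L[ℝ] ℝ :=
  F.comp (arensDotL Z f)

/-- `f ↦ f ⬝ ·` as a continuous linear map. -/
def arensDotLL : (Z →L[ℝ] ℝ) →L[ℝ] Z →L[ℝ] Z →L[ℝ] ℝ :=
  ((ContinuousLinearMap.compL ℝ Z (Z →L[ℝ] Z) (Z →L[ℝ] ℝ)).flip
      (ContinuousLinearMap.mul ℝ Z)).comp (ContinuousLinearMap.compL ℝ Z Z ℝ)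

/-- `f ↦ F ⬝ f` as a continuous linear map. -/
def arensFDotL (F : (Z →L[ℝ] ℝ) →L[ℝ] ℝ) : (Z →L[ℝ] ℝ) →L[ℝ] Z →L[ℝ] ℝ :=
  (ContinuousLinearMap.compL ℝ Z (Z →L[ℝ] ℝ) ℝ F).comp (arensDotLL Z)

/-- The *Arens product* on the norm bidual `Z''`: `(F⬝G)(f) = F(G⬝f)`. -/
def arensMul (F G : (Z →L[ℝ] ℝ) →L[ℝ] ℝ) : (Z →L[ℝ] ℝ) →L[ℝ] ℝ :=
  F.comp (arensFDotL Z G)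

/-- The canonical image of `1 ∈ Z` in the bidual `Z''`; it is the unit for the Arens
product. -/
def arensOne : (Z →L[ℝ] ℝ) →L[ℝ] ℝ := ContinuousLinearMap.apply ℝ ℝ (1 : Z)

end NormedArens

section DualOrder

variable {Z : Type*} [Lattice Z] [NormedRing Z] [NormedAlgebra ℝ Z]

/-- Positivity of a functional in `Z'`. -/
def dualNonneg (μ : Z →L[ℝ] ℝ) : Prop := ∀ a : Z, 0 ≤ a → 0 ≤ μ a

/-- The canonical order of the bidual `Z''`. -/
def bidualLe (F G : (Z →L[ℝ] ℝ) →L[ℝ] ℝ) : Prop :=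
  ∀ μ : Z →L[ℝ] ℝ, dualNonneg μ → F μ ≤ G μ

/-- `H = F ⊔ G` in the bidual `Z''`. -/
def IsBidualSup (F G H : (Z →L[ℝ] ℝ) →L[ℝ] ℝ) : Prop :=
  bidualLe F H ∧ bidualLe G H ∧
    ∀ K : (Z →L[ℝ] ℝ) →L[ℝ] ℝ, bidualLe F K → bidualLe G K → bidualLe H K

/-- `s ⊆ Z''` is downward directed with infimum `0`. -/
def BidualDownTo0 (s : Set ((Z →L[ℝ] ℝ) →L[ℝ] ℝ)) : Prop :=
  s.Nonempty ∧ (∀ F ∈ s, ∀ G ∈ s, ∃ H ∈ s, bidualLe H F ∧ bidualLe H G) ∧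
    (∀ F ∈ s, bidualLe 0 F) ∧ ∀ K, (∀ F ∈ s, bidualLe K F) → bidualLe K 0

/-- The Riesz–Kantorovich formula for `|μ|(a)`, `μ ∈ Z'`, `a ∈ Z₊`. -/
def dualAbs (μ : Z →L[ℝ] ℝ) (a : Z) : ℝ := sSup ((fun b => μ b) '' {b : Z | |b| ≤ a})

/-- Disjointness `|μ| ⊓ |ν| = 0` in `Z'`. -/
def DualDisjoint (μ ν : Z →L[ℝ] ℝ) : Prop :=
  ∀ a : Z, 0 ≤ a → ∀ ε : ℝ, 0 < ε →
    ∃ b c : Z, 0 ≤ b ∧ 0 ≤ c ∧ b + c = a ∧ dualAbs μ b + dualAbs ν c < ε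

/-- The Riesz–Kantorovich formula for `|F|(μ)`, `F ∈ Z''`, `μ ∈ Z'₊`. -/
def bidualAbs (F : (Z →L[ℝ] ℝ) →L[ℝ] ℝ) (μ : Z →L[ℝ] ℝ) : ℝ :=
  sSup ((fun ν => F ν) '' {ν : Z →L[ℝ] ℝ | ∀ a : Z, 0 ≤ a → dualAbs ν a ≤ μ a})

/-- Disjointness `|F| ⊓ |G| = 0` in `Z''`. -/
def BidualDisjoint (F G : (Z →L[ℝ] ℝ) →L[ℝ] ℝ) : Prop :=
  ∀ μ : Z →L[ℝ] ℝ, dualNonneg μ → ∀ ε : ℝ, 0 < ε →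
    ∃ μ₁ μ₂ : Z →L[ℝ] ℝ, dualNonneg μ₁ ∧ dualNonneg μ₂ ∧ μ₁ + μ₂ = μ ∧
      bidualAbs F μ₁ + bidualAbs G μ₂ < ε

end DualOrder

/-- A member of the ideal center `Z(J)` of an order ideal `J` of a Riesz space, encoded as a
map defined on the ambient space whose restriction to `J` is the actual operator. -/
def IsCentralOn {D : Type*} [Lattice D] [AddCommGroup D] [Module ℝ D]
    (J : Set D) (S : D → D) : Prop :=
  (∀ f ∈ J, S f ∈ J) ∧ (∀ f ∈ J, ∀ g ∈ J, S (f + g) = S f + S g) ∧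
    (∀ (c : ℝ), ∀ f ∈ J, S (c • f) = c • S f) ∧
    ∃ c : ℝ, ∀ f ∈ J, 0 ≤ f → -(c • f) ≤ S f ∧ S f ≤ c • f

end

/-- The Archimedean property of a Riesz space. -/
def IsArchimedeanRiesz (E : Type*) [Lattice E] [AddCommGroup E] [Module ℝ E] : Prop :=
  ∀ a b : E, (∀ ε : ℝ, 0 < ε → a ≤ ε • b) → a ≤ 0

theorem riesz_le_of_smul_le {E : Type*} [Lattice E] [AddCommGroup E] [Module ℝ E]
    [PosSMulMono ℝ E] {r : ℝ} (hr : 0 < r) {x y : E} (h : r • x ≤ r • y) : x ≤ y := by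
  have := smul_le_smul_of_nonneg_left h (inv_nonneg.2 hr.le)
  rwa [inv_smul_smul₀ hr.ne', inv_smul_smul₀ hr.ne'] at this

theorem disjoint_mono {E : Type*} [Lattice E] [Zero E] {a b d : E} (ha : 0 ≤ a) (hd : 0 ≤ d) (hab : a ≤ b) (h : b ⊓ d = 0) :
    a ⊓ d = 0 :=
  le_antisymm (h ▸ inf_le_inf_right d hab) (le_inf ha hd)

section VectorLattice

variable {E : Type*} [Lattice E] [AddCommGroup E] [CovariantClass E E (· + ·) (· ≤ ·)]

theorem riesz_abs_add_le (a b : E) : |a + b| ≤ |a| + |b| :=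
  abs_le'.2 ⟨add_le_add (le_abs_self a) (le_abs_self b), by
    rw [neg_add]; exact add_le_add (neg_le_abs a) (neg_le_abs b)⟩

theorem abs_le_add_of_le_of_le {a b c : E} (h₁ : a ≤ b) (h₂ : b ≤ c) : |b| ≤ |a| + |c| :=
  abs_le'.2 ⟨h₂.trans ((le_abs_self c).trans (le_add_of_nonneg_left (abs_nonneg a))),
    (neg_le_neg_iff.2 h₁).trans ((neg_le_abs a).trans (le_add_of_nonneg_right (abs_nonneg c)))⟩

theorem riesz_posPart_le_abs (a : E) : a⁺ ≤ |a| := sup_le (le_abs_self a) (abs_nonneg a)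

theorem riesz_negPart_le_abs (a : E) : a⁻ ≤ |a| := sup_le (neg_le_abs a) (abs_nonneg a)

theorem disjoint_add {a b d : E} (ha : 0 ≤ a) (hb : 0 ≤ b) (hd : 0 ≤ d) (h₁ : a ⊓ d = 0)
    (h₂ : b ⊓ d = 0) : (a + b) ⊓ d = 0 := by
  refine le_antisymm ?_ (le_inf (add_nonneg ha hb) hd)
  have h : (a + b) ⊓ d - a ≤ b ⊓ d :=
    le_inf (by rw [sub_le_iff_le_add']; exact inf_le_left)
      ((sub_le_self _ ha).trans inf_le_right)
  rw [h₂, sub_nonpos] at h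
  exact h₁ ▸ le_inf h inf_le_right

theorem posPart_disjoint_posPart_neg (a b : E) : (a - b)⁺ ⊓ (b - a)⁺ = 0 := by
  have := posPart_inf_negPart_eq_zero (a - b)
  rwa [← posPart_neg, neg_sub] at this

/-- Disjoint elements satisfy `|a| + |b| ≤ |a - b|`. -/
theorem abs_add_abs_le_of_disjoint {a b : E} (h : |a| ⊓ |b| = 0) : |a| + |b| ≤ |a - b| := by
  have h₁ := sup_sub_inf_eq_abs_sub |b| |a|
  have h₂ := inf_add_sup |a| |b|
  rw [h, zero_add] at h₂
  rw [sup_comm, inf_comm, h, sub_zero, h₂] at h₁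
  rw [h₁]
  exact abs_abs_sub_abs_le a b

variable [Module ℝ E] [PosSMulMono ℝ E]

theorem riesz_smul_le_smul {r s : ℝ} (h : r ≤ s) {x : E} (hx : 0 ≤ x) : r • x ≤ s • x := by
  have := smul_nonneg (sub_nonneg.2 h) hx
  rwa [sub_smul, sub_nonneg] at this

theorem riesz_abs_smul {r : ℝ} (hr : 0 ≤ r) (x : E) : |r • x| = r • |x| := by
  have key : ∀ s : ℝ, 0 ≤ s → ∀ y : E, |s • y| ≤ s • |y| := fun s hs y =>
    abs_le'.2 ⟨smul_le_smul_of_nonneg_left (le_abs_self y) hs, by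
      rw [← smul_neg]; exact smul_le_smul_of_nonneg_left (neg_le_abs y) hs⟩
  rcases hr.eq_or_lt with rfl | hr
  · simp
  refine le_antisymm (key r hr.le x) ?_
  have := smul_le_smul_of_nonneg_left (key r⁻¹ (inv_nonneg.2 hr.le) (r • x)) hr.le
  rwa [inv_smul_smul₀ hr.ne', smul_inv_smul₀ hr.ne'] at this

theorem disjoint_smul {a d : E} (ha : 0 ≤ a) (hd : 0 ≤ d) (h : a ⊓ d = 0) {r : ℝ} (hr : 0 ≤ r) :
    (r • a) ⊓ d = 0 := by
  refine le_antisymm ?_ (le_inf (smul_nonneg hr ha) hd)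
  have hM : 0 < max r 1 := lt_max_of_lt_right one_pos
  refine riesz_le_of_smul_le (inv_pos.2 hM) ?_
  rw [smul_zero, ← h]
  refine le_inf ?_ ?_
  · refine riesz_le_of_smul_le hM ?_
    rw [smul_inv_smul₀ hM.ne']
    exact inf_le_left.trans (riesz_smul_le_smul (le_max_left _ _) ha)
  · refine riesz_le_of_smul_le hM ?_
    rw [smul_inv_smul₀ hM.ne']
    refine inf_le_right.trans ?_
    simpa using riesz_smul_le_smul (le_max_right r 1) hd

/-- An element below all `|a - j e|`, where the points `j e` form a grid around `a`, is at
most `e`. -/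
theorem le_of_forall_le_abs_grid {a e y : E} {n : ℕ} (ha : 0 ≤ a) (he : 0 ≤ e)
    (han : a ≤ (n : ℝ) • e) (hy : ∀ j : ℕ, j ≤ n → y ≤ |a - (j : ℝ) • e|) : y ≤ e := by
  have key : ∀ j : ℕ, j ≤ n → y ≤ e + (a - (j : ℝ) • e)⁺ := by
    intro j
    induction j with
    | zero =>
      intro h
      have := hy 0 h
      simp only [Nat.cast_zero, zero_smul, sub_zero, abs_of_nonneg ha, posPart_of_nonneg ha] at this ⊢
      exact this.trans (le_add_of_nonneg_left he)
    | succ j ih =>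
      intro h
      have h₁ := ih (by omega)
      have h₂ := hy _ h
      set t := a - ((j + 1 : ℕ) : ℝ) • e with ht
      have hs : a - (j : ℝ) • e = t + e := by rw [ht]; push_cast; module
      rw [hs] at h₁
      let _ : DistribLattice E := AddCommGroup.toDistribLattice E
      have h₃ : y ≤ (t ⊔ -t) ⊓ ((e + (t + e)) ⊔ e) := by
        refine le_inf h₂ (h₁.trans ?_)
        rw [posPart_def, add_sup, add_zero]
      have hte : e ≤ e + t⁺ := le_add_of_nonneg_right (posPart_nonneg t)
      refine h₃.trans ?_
      rw [inf_sup_right, inf_sup_left (-t)]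
      refine sup_le (inf_le_left.trans ((le_posPart t).trans (le_add_of_nonneg_left he)))
        (sup_le ((?_ : _ ≤ e).trans hte) (inf_le_right.trans hte))
      refine riesz_le_of_smul_le (two_pos : (0 : ℝ) < 2) ?_
      rw [two_smul ℝ (-t ⊓ (e + (t + e)))]
      refine (add_le_add (inf_le_left (a := -t)) inf_le_right).trans (le_of_eq ?_)
      module
  have := key n le_rfl
  rwa [posPart_of_nonpos (sub_nonpos.2 han), add_zero] at this

/-- An element disjoint from all the bumps `(2e - |a - j e|)⁺` around a grid for `a` is
disjoint from `e`. -/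
theorem disjoint_of_forall_disjoint_grid (harch : IsArchimedeanRiesz E) {a e G : E} {n : ℕ}
    (ha : 0 ≤ a) (he : 0 ≤ e) (hG : 0 ≤ G) (han : a ≤ (n : ℝ) • e)
    (h : ∀ j : ℕ, j ≤ n → G ⊓ ((2 : ℝ) • e - |a - (j : ℝ) • e|)⁺ = 0) : G ⊓ e = 0 := by
  have he2 : e ≤ (2 : ℝ) • e := by simpa using riesz_smul_le_smul (one_le_two (α := ℝ)) he
  have key : ∀ r : ℝ, 0 ≤ r → (r • G) ⊓ ((2 : ℝ) • e) ≤ e := by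
    intro r hr
    refine le_of_forall_le_abs_grid ha he han fun j hj => ?_
    set d := ((2 : ℝ) • e - |a - (j : ℝ) • e|)⁺ with hd
    have h0 : 0 ≤ (r • G) ⊓ ((2 : ℝ) • e) := le_inf (smul_nonneg hr hG) (he.trans he2)
    have h1 : (r • G) ⊓ ((2 : ℝ) • e) ⊓ d = 0 :=
      disjoint_mono h0 (posPart_nonneg _) inf_le_left
        (disjoint_smul hG (posPart_nonneg _) (h j hj) hr)
    have h2 := inf_add_sup ((r • G) ⊓ ((2 : ℝ) • e)) d
    rw [h1, zero_add] at h2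
    have h3 : (r • G) ⊓ ((2 : ℝ) • e) ⊔ d ≤ (2 : ℝ) • e :=
      sup_le inf_le_right (sup_le (sub_le_self _ (abs_nonneg _)) (he.trans he2))
    rw [h2] at h3
    have h4 : (2 : ℝ) • e - |a - (j : ℝ) • e| ≤ d := le_posPart _
    have h5 := (add_le_add_right h4 ((r • G) ⊓ ((2 : ℝ) • e))).trans h3
    rw [← sub_nonneg] at h5 ⊢
    convert h5 using 1
    abel
  have hmul : ∀ m : ℕ, (m : ℝ) • (G ⊓ e) ≤ e := by
    intro m
    induction m with
    | zero => simpa using he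
    | succ m ih =>
      refine le_trans (le_inf ?_ ?_) (key ((m + 1 : ℕ) : ℝ) (Nat.cast_nonneg _))
      · exact smul_le_smul_of_nonneg_left inf_le_left (Nat.cast_nonneg _)
      · push_cast
        rw [add_smul, one_smul, two_smul]
        exact add_le_add ih inf_le_right
  refine le_antisymm (harch _ e fun ε hε => ?_) (le_inf hG he)
  obtain ⟨m, hm⟩ := exists_nat_gt ε⁻¹
  have hm0 : (0 : ℝ) < m := (inv_pos.2 hε).trans hm
  refine riesz_le_of_smul_le hm0 ((hmul m).trans ?_)
  rw [smul_smul]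
  have : 1 ≤ (m : ℝ) * ε := by
    rw [inv_lt_iff_one_lt_mul₀ hε] at hm
    linarith
  simpa using riesz_smul_le_smul this he

/-- The positive part of an operator dominated by a multiple of the identity is monotone. -/
theorem posPart_map_le_posPart_map (harch : IsArchimedeanRiesz E) {S : E →ₗ[ℝ] E} {c : ℝ}
    (hc : 0 ≤ c) (hS : ∀ z, |S z| ≤ c • |z|) {v w : E} (hv : 0 ≤ v) (hvw : v ≤ w) :
    (S v)⁺ ≤ (S w)⁺ := by
  refine sup_le ?_ (posPart_nonneg _)
  have hw : 0 ≤ w := hv.trans hvw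
  rw [← sub_nonpos]
  refine harch _ (c • w) fun ε hε => ?_
  obtain ⟨n, hn⟩ := exists_nat_gt (1 / ε)
  have hn0 : (0 : ℝ) < n := (by positivity : 0 < 1 / ε).trans hn
  have hδ : 1 / (n : ℝ) ≤ ε := (one_div_lt hε hn0).1 hn |>.le
  have hcw : 0 ≤ c • w := smul_nonneg hc hw
  refine le_trans ?_ (riesz_smul_le_smul hδ hcw)
  refine le_of_forall_le_abs_grid (a := c • v) (n := n) (smul_nonneg hc hv)
    (smul_nonneg (by positivity) hcw) ?_ fun j hj => ?_
  · rw [smul_smul, mul_one_div_cancel hn0.ne', one_smul]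
    exact smul_le_smul_of_nonneg_left hvw hc
  · set l : ℝ := j * (1 / n) with hl
    have hz : c • v - (j : ℝ) • (1 / (n : ℝ)) • c • w = c • (v - l • w) := by
      rw [hl]; module
    rw [hz, riesz_abs_smul hc]
    refine le_trans ?_ ((le_abs_self _).trans (hS _))
    rw [map_sub, map_smul]
    have hl0 : 0 ≤ l := by positivity
    have hl1 : l ≤ 1 := by
      rw [hl, mul_one_div]
      exact (div_le_one hn0).2 (by exact_mod_cast hj)
    refine sub_le_sub_left ?_ _
    refine (smul_le_smul_of_nonneg_left (le_posPart (S w)) hl0).trans ?_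
    simpa using riesz_smul_le_smul hl1 (posPart_nonneg (S w))

theorem disjoint_map_posPart_negPart {S : E →ₗ[ℝ] E} {c : ℝ}
    (hc : 0 ≤ c) (hS : ∀ z, |S z| ≤ c • |z|) (v : E) : |S v⁺| ⊓ |S v⁻| = 0 := by
  have hp := hS v⁺
  have hn := hS v⁻
  rw [abs_of_nonneg (posPart_nonneg v)] at hp
  rw [abs_of_nonneg (negPart_nonneg v)] at hn
  refine disjoint_mono (abs_nonneg _) (abs_nonneg _) hp
    (disjoint_smul (posPart_nonneg _) (abs_nonneg _) ?_ hc)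
  rw [inf_comm]
  refine disjoint_mono (abs_nonneg _) (posPart_nonneg _) hn
    (disjoint_smul (negPart_nonneg _) (posPart_nonneg _) ?_ hc)
  rw [inf_comm]
  exact posPart_inf_negPart_eq_zero v

theorem abs_map_abs_le {S : E →ₗ[ℝ] E} {c : ℝ} (hc : 0 ≤ c) (hS : ∀ z, |S z| ≤ c • |z|) (w : E) :
    |S (|w|)| ≤ |S w| := by
  rw [← posPart_add_negPart w, map_add]
  refine (riesz_abs_add_le _ _).trans
    ((abs_add_abs_le_of_disjoint (disjoint_map_posPart_negPart hc hS w)).trans (le_of_eq ?_))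
  rw [← map_sub, posPart_sub_negPart]

/-- Operators dominated by a multiple of the identity are monotone in modulus. -/
theorem abs_map_le_abs_map_of_abs_le (harch : IsArchimedeanRiesz E) {S : E →ₗ[ℝ] E} {c : ℝ}
    (hc : 0 ≤ c) (hS : ∀ z, |S z| ≤ c • |z|) {v w : E} (hvw : |v| ≤ |w|) : |S v| ≤ |S w| := by
  have key : ∀ u : E, 0 ≤ u → u ≤ |w| → |S u| ≤ |S w| := by
    intro u hu huw
    refine le_trans ?_ (abs_map_abs_le hc hS w)
    refine abs_le'.2 ⟨?_, ?_⟩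
    · exact (le_posPart _).trans ((posPart_map_le_posPart_map harch hc hS hu huw).trans
        (riesz_posPart_le_abs _))
    · have := posPart_map_le_posPart_map harch (S := -S) hc (by simpa using hS) hu huw
      exact (le_posPart _).trans (this.trans ((riesz_posPart_le_abs _).trans (by simp)))
  have hp := key v⁺ (posPart_nonneg v) ((riesz_posPart_le_abs v).trans hvw)
  have hn := key v⁻ (negPart_nonneg v) ((riesz_negPart_le_abs v).trans hvw)
  have h₁ := inf_add_sup |S v⁺| |S v⁻|
  rw [disjoint_map_posPart_negPart hc hS v, zero_add] at h₁
  calc |S v| = |S v⁺ + -S v⁻| := by rw [← sub_eq_add_neg, ← map_sub, posPart_sub_negPart]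
    _ ≤ |S v⁺| + |-S v⁻| := riesz_abs_add_le _ _
    _ ≤ |S w| := by rw [abs_neg, ← h₁]; exact sup_le hp hn

theorem posPart_sub_abs_map_mono (harch : IsArchimedeanRiesz E) {S : E →ₗ[ℝ] E} {c : ℝ}
    (hc : 0 ≤ c) (hS : ∀ z, |S z| ≤ c • |z|) {x b : E} (hx : 0 ≤ x) (hxb : x ≤ b) {ε : ℝ}
    (hε : 0 ≤ ε) : (ε • x - |S x|)⁺ ≤ (ε • b - |S b|)⁺ := by
  have key : ∀ R : E →ₗ[ℝ] E, (∀ z, |R z| ≤ c • |z|) →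
      (ε • x - |S x|) ≤ ε • x - R x → (ε • x - |S x|)⁺ ≤ (ε • b - R b)⁺ := by
    intro R hR hRx
    refine (posPart_mono hRx).trans ?_
    refine posPart_map_le_posPart_map harch (S := ε • LinearMap.id - R) (c := ε + c)
      (by positivity) (fun z => ?_) hx hxb
    calc |(ε • LinearMap.id - R : E →ₗ[ℝ] E) z| = |ε • z + -R z| := by
          simp [sub_eq_add_neg]
      _ ≤ |ε • z| + |-R z| := riesz_abs_add_le _ _
      _ ≤ ε • |z| + c • |z| := by
          rw [riesz_abs_smul hε, abs_neg]; exact add_le_add_right (hR z) _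
      _ = (ε + c) • |z| := (add_smul _ _ _).symm
  have h₁ := key S hS (sub_le_sub_left (le_abs_self _) _)
  have h₂ := key (-S) (by simpa using hS) (sub_le_sub_left (neg_le_abs _) _)
  refine (le_inf h₁ h₂).trans (le_of_eq ?_)
  let _ : DistribLattice E := AddCommGroup.toDistribLattice E
  rw [posPart_def, posPart_def, posPart_def, ← sup_inf_right]
  congr 1
  rw [abs, sub_sup, LinearMap.neg_apply]

theorem posPart_commutator_disjoint (harch : IsArchimedeanRiesz E) {S T : E →ₗ[ℝ] E} {c : ℝ}
    (hc : 0 ≤ c) (hS : ∀ z, |S z| ≤ c • |z|) (hT : IsBandPres T) {x b : E} (hx : 0 ≤ x)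
    (hxb : x ≤ b) (hTb : ∀ z, |z| ≤ x → |T z| ≤ b) {ε : ℝ} (hε : 0 < ε) (l : ℝ) :
    (|T (S x) - S (T x)| - (2 * ε) • b)⁺ ⊓ (ε • x - |S x - l • x|)⁺ = 0 := by
  set R : E →ₗ[ℝ] E := S - l • LinearMap.id with hRdef
  have hRx : ∀ y, R y = S y - l • y := fun y => by simp [hRdef]
  have hR : ∀ z, |R z| ≤ (c + |l|) • |z| := by
    intro z
    have hl : |l • z| ≤ |l| • |z| := by
      rcases le_total 0 l with h | h
      · rw [riesz_abs_smul h, abs_of_nonneg h]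
      · rw [← neg_neg (l • z), abs_neg, ← neg_smul, riesz_abs_smul (neg_nonneg.2 h),
          abs_of_nonpos h]
    rw [hRx, sub_eq_add_neg, add_smul]
    refine (riesz_abs_add_le _ _).trans (add_le_add (hS z) ?_)
    rwa [abs_neg]
  have hc' : 0 ≤ c + |l| := by positivity
  rw [← hRx x]
  set z := R x with hz
  set e := ε • x with he
  have he0 : 0 ≤ e := smul_nonneg hε.le hx
  have hb : 0 ≤ b := hx.trans hxb
  have hcomm : T (S x) - S (T x) = T z - R (T x) := by
    rw [hz, hRx, hRx, map_sub, map_smul]; abel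
  set r₁ := (z⁺ - e)⁺
  set r₂ := (z⁻ - e)⁺
  set d := (e - |z|)⁺
  have hd : 0 ≤ d := posPart_nonneg _
  have hr : ∀ a, 0 ≤ a → a ≤ |z| → (0 ≤ a - (a - e)⁺ ∧ a - (a - e)⁺ ≤ e) ∧
      |T (a - e)⁺| ⊓ d = 0 := by
    intro a ha haz
    refine ⟨⟨sub_nonneg.2 (sup_le (sub_le_self _ he0) ha), sub_le_comm.1 (le_posPart _)⟩, ?_⟩
    rw [← abs_of_nonneg hd]
    apply hT
    rw [abs_of_nonneg hd, abs_of_nonneg (posPart_nonneg _)]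
    exact disjoint_mono (posPart_nonneg _) hd (posPart_mono (sub_le_sub_right haz e))
      (posPart_disjoint_posPart_neg _ _)
  obtain ⟨⟨hk₁, hk₁'⟩, hr₁⟩ := hr z⁺ (posPart_nonneg z) (riesz_posPart_le_abs z)
  obtain ⟨⟨hk₂, hk₂'⟩, hr₂⟩ := hr z⁻ (negPart_nonneg z) (riesz_negPart_le_abs z)
  set k := (z⁺ - r₁) - (z⁻ - r₂) with hk
  have hke : |k| ≤ e := by
    refine abs_le'.2 ⟨(sub_le_self _ hk₂).trans hk₁', ?_⟩
    rw [hk, neg_sub]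
    exact (sub_le_self _ hk₁).trans hk₂'
  have hTk : |T k| ≤ ε • b := by
    have h : |T (ε⁻¹ • k)| ≤ b := by
      apply hTb
      rw [riesz_abs_smul (inv_nonneg.2 hε.le)]
      refine riesz_le_of_smul_le hε ?_
      rwa [smul_inv_smul₀ hε.ne']
    rw [map_smul, riesz_abs_smul (inv_nonneg.2 hε.le)] at h
    have := smul_le_smul_of_nonneg_left h hε.le
    rwa [smul_inv_smul₀ hε.ne'] at this
  have hTz : |T z| ≤ ε • b + (|T r₁| + |T r₂|) := by
    have h : T z = T k + (T r₁ + -T r₂) := by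
      rw [← map_neg, ← map_add, ← map_add, ← posPart_sub_negPart z, hk]
      congr 1; abel
    rw [h]
    refine (riesz_abs_add_le _ _).trans (add_le_add hTk ((riesz_abs_add_le _ _).trans ?_))
    rw [abs_neg]
  have hRT : |R (T x)| ≤ |R b| := by
    refine abs_map_le_abs_map_of_abs_le harch hc' hR ?_
    rw [abs_of_nonneg hb]
    exact hTb x (abs_of_nonneg hx).le
  have hRb : (|R b| - ε • b)⁺ ⊓ d = 0 := by
    rw [inf_comm]
    exact disjoint_mono hd (posPart_nonneg _)
      (posPart_sub_abs_map_mono harch hc' hR hx hxb hε.le) (posPart_disjoint_posPart_neg _ _)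
  have hsum : 0 ≤ |T r₁| + |T r₂| := add_nonneg (abs_nonneg _) (abs_nonneg _)
  refine disjoint_mono (posPart_nonneg _) hd (b := (|R b| - ε • b)⁺ + (|T r₁| + |T r₂|)) ?_
    (disjoint_add (posPart_nonneg _) hsum hd hRb
      (disjoint_add (abs_nonneg _) (abs_nonneg _) hd hr₁ hr₂))
  refine sup_le ?_ (add_nonneg (posPart_nonneg _) hsum)
  have h₁ : |T (S x) - S (T x)| ≤ ε • b + (|T r₁| + |T r₂|) + |R b| := by
    rw [hcomm, sub_eq_add_neg]
    refine (riesz_abs_add_le _ _).trans (add_le_add hTz ?_)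
    rwa [abs_neg]
  calc |T (S x) - S (T x)| - (2 * ε) • b
      ≤ ε • b + (|T r₁| + |T r₂|) + |R b| - (2 * ε) • b := sub_le_sub_right h₁ _
    _ = (|R b| - ε • b) + (|T r₁| + |T r₂|) := by module
    _ ≤ _ := add_le_add_left (le_posPart _) _

/-- Orthomorphisms commute with operators dominated by a multiple of the identity. -/
theorem IsBandPres.commute (harch : IsArchimedeanRiesz E) {S T : E →ₗ[ℝ] E} {c : ℝ}
    (hc : 0 ≤ c) (hS : ∀ z, |S z| ≤ c • |z|) (hSb : IsBandPres S) (hT : IsBandPres T)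
    (hTb : IsOrdBdd T) (x : E) : T (S x) = S (T x) := by
  suffices key : ∀ x : E, 0 ≤ x → T (S x) = S (T x) by
    rw [← posPart_sub_negPart x]
    simp only [map_sub, key _ (posPart_nonneg x), key _ (negPart_nonneg x)]
  intro x hx
  obtain ⟨p, q, hpq⟩ := hTb (-x) x
  set b := |p| + |q| + x
  have hpq0 : 0 ≤ |p| + |q| := add_nonneg (abs_nonneg _) (abs_nonneg _)
  have hxb : x ≤ b := le_add_of_nonneg_left hpq0
  have hTx : ∀ z, |z| ≤ x → |T z| ≤ b := fun z hz => by
    obtain ⟨h₁, h₂⟩ := hpq z (neg_le.1 (abs_le'.1 hz).2) (abs_le'.1 hz).1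
    exact (abs_le_add_of_le_of_le h₁ h₂).trans (le_add_of_nonneg_right hx)
  suffices h : |T (S x) - S (T x)| ≤ 0 from
    sub_eq_zero.1 (le_antisymm (abs_le'.1 h).1 (neg_nonpos.1 (abs_le'.1 h).2))
  refine harch _ b fun ε' hε' => ?_
  obtain ⟨ε, hε, rfl⟩ : ∃ ε, 0 < ε ∧ ε' = 2 * ε := ⟨ε' / 2, by positivity, by ring⟩
  set G := (|T (S x) - S (T x)| - (2 * ε) • b)⁺ with hG
  have hG0 : 0 ≤ G := posPart_nonneg _
  obtain ⟨n, hn⟩ := exists_nat_ge (2 * c / (ε / 2))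
  have hSx := hS x
  rw [abs_of_nonneg hx] at hSx
  have hgrid : G ⊓ (ε / 2) • x = 0 := by
    refine disjoint_of_forall_disjoint_grid harch (a := S x + c • x) (n := n) ?_
      (smul_nonneg (by positivity) hx) hG0 ?_ fun j _ => ?_
    · exact neg_le_iff_add_nonneg.1 (neg_le.1 (abs_le'.1 hSx).2)
    · rw [smul_smul]
      rw [div_le_iff₀ (by positivity)] at hn
      refine le_trans ?_ (riesz_smul_le_smul hn hx)
      rw [mul_smul, two_smul]
      exact add_le_add_left (abs_le'.1 hSx).1 _
    · have h := posPart_commutator_disjoint harch hc hS hT hx hxb hTx hε (j * (ε / 2) - c)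
      convert h using 4
      · module
      · congr 1; module
  have hGx : |x| ⊓ |G| = 0 := by
    rw [abs_of_nonneg hx, abs_of_nonneg hG0]
    have h := disjoint_smul (smul_nonneg (half_pos hε).le hx) hG0 (inf_comm G _ ▸ hgrid)
      (inv_nonneg.2 (half_pos hε).le)
    rwa [inv_smul_smul₀ (half_pos hε).ne'] at h
  have h₁ := hT _ _ (hSb _ _ hGx)
  have h₂ := hSb _ _ (hT _ _ hGx)
  rw [abs_of_nonneg hG0] at h₁ h₂
  have hGle : G ≤ |T (S x)| + |S (T x)| := by
    refine sup_le ?_ (add_nonneg (abs_nonneg _) (abs_nonneg _))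
    refine (sub_le_self _ (smul_nonneg (by positivity) (hx.trans hxb))).trans ?_
    rw [sub_eq_add_neg, ← abs_neg (S (T x))]
    exact riesz_abs_add_le _ _
  have hGG := disjoint_mono hG0 hG0 hGle
    (disjoint_add (abs_nonneg _) (abs_nonneg _) hG0 h₁ h₂)
  rw [inf_idem, hG, posPart_eq_zero, sub_nonpos] at hGG
  exact hGG

theorem IsCentral.exists_abs_le {S : E → E} (hS : IsCentral S) :
    ∃ c : ℝ, 0 ≤ c ∧ ∀ z, |S z| ≤ c • |z| := by
  obtain ⟨⟨hlin, -, -⟩, c, hc⟩ := hS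
  refine ⟨|c|, abs_nonneg c, fun z => ?_⟩
  have key : ∀ x : E, 0 ≤ x → |S x| ≤ |c| • x := fun x hx => by
    have h := riesz_smul_le_smul (le_abs_self c) hx
    exact abs_le'.2 ⟨(hc x hx).2.trans h, (neg_le.1 (hc x hx).1).trans h⟩
  have hz : S z = S z⁺ + -S z⁻ := by
    rw [← sub_eq_add_neg, ← hlin.map_sub, posPart_sub_negPart]
  rw [hz, ← posPart_add_negPart z, smul_add]
  refine (riesz_abs_add_le _ _).trans
    (add_le_add ?_ ?_)
  · exact key _ (posPart_nonneg z)
  · rw [abs_neg]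
    exact key _ (negPart_nonneg z)

end VectorLattice

section OrderDual

variable {E D : Type*} [Lattice E] [AddCommGroup E] [Module ℝ E]
  [Lattice D] [AddCommGroup D] [Module ℝ D]
  {pE : D → E → ℝ}

namespace IsOrderDual

theorem nonneg (hD : IsOrderDual E D pE) {f : D} (hf : 0 ≤ f) {x : E} (hx : 0 ≤ x) :
    0 ≤ pE f x := by
  have := (hD.le_iff 0 f).1 hf x hx
  rwa [(hD.lin_vec x).map_zero] at this

theorem eq_zero_of_forall_nonneg [CovariantClass D D (· + ·) (· ≤ ·)]
    (hD : IsOrderDual E D pE) (hsep : SepPoints pE) {x : E} (h : ∀ f : D, 0 ≤ f → pE f x = 0) : x = 0 :=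
  hsep x fun f => by
    rw [← posPart_sub_negPart f, (hD.lin_vec x).map_sub, h _ (posPart_nonneg f),
      h _ (negPart_nonneg f), sub_zero]

variable [CovariantClass E E (· + ·) (· ≤ ·)]

theorem mono (hD : IsOrderDual E D pE) {f : D} (hf : 0 ≤ f) {x y : E} (hxy : x ≤ y) :
    pE f x ≤ pE f y := by
  have := hD.nonneg hf (sub_nonneg.2 hxy)
  rwa [(hD.lin_fun f).map_sub, sub_nonneg] at this

theorem abs_apply_le (hD : IsOrderDual E D pE) {f : D} (hf : 0 ≤ f) (x : E) :
    |pE f x| ≤ pE f |x| :=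
  abs_le'.2 ⟨hD.mono hf (le_abs_self x), by
    rw [← (hD.lin_fun f).map_neg]; exact hD.mono hf (neg_le_abs x)⟩

/-- A linear functional on `V` dominated through `A : V → E` by a positive functional on `E`
factors through `A`. -/
theorem exists_apply_eq [PosSMulMono ℝ E] (hD : IsOrderDual E D pE) {V : Type*} [AddCommGroup V]
    [Module ℝ V] (A : V →ₗ[ℝ] E) (β : V →ₗ[ℝ] ℝ) {f : D} (hf : 0 ≤ f)
    (h : ∀ s, |β s| ≤ pE f |A s|) : ∃ g : D, ∀ s, pE g (A s) = β s := by
  have hker : LinearMap.ker A ≤ LinearMap.ker β := fun s hs => by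
    have := h s
    rw [LinearMap.mem_ker.1 hs, abs_zero, (hD.lin_fun f).map_zero] at this
    exact abs_nonpos_iff.1 this
  let β' : LinearMap.range A →ₗ[ℝ] ℝ :=
    ((LinearMap.ker A).liftQ β hker).comp A.quotKerEquivRange.symm.toLinearMap
  have hβ' : ∀ s, β' ⟨A s, s, rfl⟩ = β s := fun s => by
    have : A.quotKerEquivRange.symm ⟨A s, s, rfl⟩ = Submodule.Quotient.mk s := by
      rw [LinearEquiv.symm_apply_eq]; rfl
    simp [β', this]
  obtain ⟨g, hg, hgN⟩ := exists_extension_of_le_sublinear ⟨LinearMap.range A, β'⟩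
    (fun x => pE f |x|)
    (fun c hc x => by rw [riesz_abs_smul hc.le, (hD.lin_fun f).map_smul, smul_eq_mul])
    (fun x y => by
      rw [← (hD.lin_fun f).map_add]; exact hD.mono hf (riesz_abs_add_le x y))
    (by
      rintro ⟨_, s, rfl⟩
      exact (hβ' s).le.trans ((le_abs_self _).trans (h s)))
  obtain ⟨g', hg'⟩ := hD.surj g g.isLinear fun a b =>
    ⟨-pE f (|a| + |b|), pE f (|a| + |b|), fun x hax hxb => by
      have hx := hD.mono hf (abs_le_add_of_le_of_le hax hxb)
      have h₁ := hgN x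
      have h₂ := hgN (-x)
      simp only [map_neg, abs_neg] at h₁ h₂
      constructor <;> linarith⟩
  exact ⟨g', fun s => by rw [hg', ← hβ' s]; exact hg ⟨A s, s, rfl⟩⟩

variable [CovariantClass D D (· + ·) (· ≤ ·)]

theorem exists_nonneg_abs_apply_le (hD : IsOrderDual E D pE) (f : D) :
    ∃ q : D, 0 ≤ q ∧ ∀ x, |pE f x| ≤ pE q |x| := by
  refine ⟨f⁺ + f⁻, add_nonneg (posPart_nonneg f) (negPart_nonneg f), fun x => ?_⟩
  have h : pE f x = pE f⁺ x - pE f⁻ x := by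
    rw [← (hD.lin_vec x).map_sub, posPart_sub_negPart]
  rw [h, (hD.lin_vec _).map_add]
  exact (abs_sub _ _).trans
    (add_le_add (hD.abs_apply_le (posPart_nonneg f) x) (hD.abs_apply_le (negPart_nonneg f) x))

theorem isArchimedeanRiesz [PosSMulMono ℝ E] (hD : IsOrderDual E D pE) (hsep : SepPoints pE) :
    IsArchimedeanRiesz E := by
  intro a b hab
  rw [← posPart_eq_zero]
  refine hD.eq_zero_of_forall_nonneg hsep fun f hf => ?_
  refine le_antisymm ?_ (hD.nonneg hf (posPart_nonneg a))
  have hfb := hD.nonneg hf (abs_nonneg b)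
  refine le_of_forall_pos_le_add fun ε hε => ?_
  have hδ : 0 < ε / (pE f |b| + 1) := by positivity
  have h₁ : a⁺ ≤ (ε / (pE f |b| + 1)) • |b| :=
    sup_le ((hab _ hδ).trans (smul_le_smul_of_nonneg_left (le_abs_self b) hδ.le))
      (smul_nonneg hδ.le (abs_nonneg b))
  have h₂ := hD.mono hf h₁
  rw [(hD.lin_fun f).map_smul, smul_eq_mul] at h₂
  have h₃ : ε / (pE f |b| + 1) * pE f |b| ≤ ε := by
    rw [div_mul_eq_mul_div, div_le_iff₀ (by positivity)]
    nlinarith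
  linarith

/-- An order bounded operator commuting with a topologically full center is band preserving. -/
theorem isBandPres_of_commute [PosSMulMono ℝ E] (hD : IsOrderDual E D pE) (hsep : SepPoints pE)
    {Z : Type*} [Lattice Z] [NormedRing Z] [NormedAlgebra ℝ Z] {ρ : Z → E → E}
    (hZ : IsCenterOf E Z ρ) (htf : TopFullCenter pE ρ) {T : E → E} (hTlin : IsLinearMap ℝ T)
    (hTb : IsOrdBdd T) (hT : ∀ (S : Z) (x : E), T (ρ S x) = ρ S (T x)) : IsBandPres T := by
  classical
  have harch := hD.isArchimedeanRiesz hsep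
  have hmono : ∀ (S : Z) {a b : E}, |a| ≤ |b| → |ρ S a| ≤ |ρ S b| := fun S a b hab => by
    obtain ⟨c, hc, hS⟩ := (hZ.central S).exists_abs_le
    exact abs_map_le_abs_map_of_abs_le harch (S := (hZ.central S).1.1.mk' _) hc hS hab
  intro x y hxy
  have hdisj : ∀ S R : Z, |ρ S (|x|)| ⊓ |ρ R (|y|)| = 0 := fun S R => by
    refine (hZ.central S).1.2.2 _ _ ?_
    rw [inf_comm]
    refine (hZ.central R).1.2.2 _ _ ?_
    rwa [abs_abs, abs_abs, inf_comm]
  have hadd : ∀ S R : Z, |ρ S (|x|)| + |ρ R (|y|)| ≤ |ρ S (|x|) + ρ R (|y|)| := fun S R => by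
    have h := abs_add_abs_le_of_disjoint (a := ρ S (|x|)) (b := -ρ R (|y|))
      (by rw [abs_neg]; exact hdisj S R)
    rwa [abs_neg, sub_neg_eq_add] at h
  set v := |T x| ⊓ |y| with hv
  have hv0 : 0 ≤ v := le_inf (abs_nonneg _) (abs_nonneg _)
  refine hD.eq_zero_of_forall_nonneg hsep fun f hf => ?_
  let L : E → Z →ₗ[ℝ] E := fun z => (hZ.lin_vec z).mk' _
  let P : D → E →ₗ[ℝ] ℝ := fun g => (hD.lin_fun g).mk' _
  obtain ⟨g, hg⟩ := hD.exists_apply_eq (L (T x)) ((P f).comp (L v)) hf fun S =>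
    (hD.abs_apply_le hf _).trans (hD.mono hf (hmono S (by
      rw [abs_of_nonneg hv0]; exact inf_le_left)))
  obtain ⟨φ, hφ⟩ := hD.surj (fun z => pE g (T z)) ((P g).comp (hTlin.mk' T)).isLinear
    fun a b => by
      obtain ⟨c, d, hcd⟩ := hTb a b
      obtain ⟨c', d', hcd'⟩ := hD.bdd g c d
      exact ⟨c', d', fun z h₁ h₂ => hcd' _ (hcd z h₁ h₂).1 (hcd z h₁ h₂).2⟩
  have hφv : ∀ S : Z, pE φ (ρ S x) = pE f (ρ S v) := fun S => by
    rw [hφ, hT]; exact hg S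
  obtain ⟨q, hq, hφq⟩ := hD.exists_nonneg_abs_apply_le φ
  let A : Z × Z →ₗ[ℝ] E := (L |x|).coprod (L |y|)
  obtain ⟨h, hh⟩ := hD.exists_apply_eq A (((P φ).comp (L x)).comp (LinearMap.fst ℝ Z Z)) hq
    fun s => (hφq _).trans (hD.mono hq
      ((hmono s.1 (abs_abs x).ge).trans
        ((le_add_of_nonneg_right (abs_nonneg _)).trans (hadd s.1 s.2))))
  obtain ⟨l, hl⟩ := hD.exists_apply_eq A (((P f).comp (L v)).comp (LinearMap.snd ℝ Z Z)) hf
    fun s => (hD.abs_apply_le hf _).trans (hD.mono hf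
      ((hmono s.2 (by rw [abs_of_nonneg hv0, abs_abs]; exact inf_le_right)).trans
        ((le_add_of_nonneg_left (abs_nonneg _)).trans (hadd s.1 s.2))))
  have hA : ∀ S : Z, A (S, S) = ρ S (|x| + |y|) := fun S =>
    ((hZ.central S).1.1.map_add _ _).symm
  have hAy : A (0, 1) = |y| := by
    change ρ 0 (|x|) + ρ 1 (|y|) = |y|
    rw [(hZ.lin_vec _).map_zero, hZ.map_one, zero_add]
  have hhS : ∀ S, pE h (ρ S (|x| + |y|)) = pE f (ρ S v) := fun S => by
    rw [← hA, hh, ← hφv]; rfl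
  have hlS : ∀ S, pE l (ρ S (|x| + |y|)) = pE f (ρ S v) := fun S => by
    rw [← hA, hl]; rfl
  have hhy : pE h |y| = 0 := by
    rw [← hAy, hh]
    change pE φ (ρ 0 x) = 0
    rw [(hZ.lin_vec _).map_zero, (hD.lin_fun φ).map_zero]
  have hly : pE l |y| = pE f v := by
    rw [← hAy, hl]
    change pE f (ρ 1 v) = _
    rw [hZ.map_one]
  rw [← abs_nonpos_iff]
  refine le_of_forall_pos_le_add fun ε hε => ?_
  obtain ⟨_, ⟨S, rfl⟩, hS⟩ := htf (|x| + |y|) (add_nonneg (abs_nonneg _) (abs_nonneg _)) |y|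
    ⟨1, zero_le_one, by
      rw [abs_abs, one_smul]; exact le_add_of_nonneg_left (abs_nonneg _)⟩ {h, l} (ε / 2)
    (by positivity)
  have h₁ := hS h (by simp)
  have h₂ := hS l (by simp)
  rw [hhS, hhy, sub_zero, abs_lt] at h₁
  rw [hlS, hly, abs_lt] at h₂
  rw [abs_le]
  constructor <;> linarith

end IsOrderDual

end OrderDual

/-- Corollary 4.  Let `E` be a Riesz space with point separating order
dual (realized as `D`) and topologically full center (`Z` realizing `Z(E)`).  An order
bounded linear operator `T` on `E` commutes with every operator in `Z(E)` if and only if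
`T` is an orthomorphism; in particular the commutant of `Z(E)` in the order bounded
operators `L_b(E)` is `Orth(E)`. -/
theorem statement13
    {E D Z : Type*}
    [Lattice E] [AddCommGroup E] [Module ℝ E]
    [CovariantClass E E (· + ·) (· ≤ ·)] [PosSMulMono ℝ E]
    [Lattice D] [AddCommGroup D] [Module ℝ D]
    [CovariantClass D D (· + ·) (· ≤ ·)] [PosSMulMono ℝ D]
    [Lattice Z] [NormedRing Z] [NormedAlgebra ℝ Z]
    [CovariantClass Z Z (· + ·) (· ≤ ·)] [PosSMulMono ℝ Z]
    (pE : D → E → ℝ) (hD : IsOrderDual E D pE) (hsep : SepPoints pE)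
    (ρ : Z → E → E) (hZ : IsCenterOf E Z ρ)
    -- `E` has a topologically full center:
    (htf : TopFullCenter pE ρ) :
    -- an order bounded operator commutes with `Z(E)` iff it is an orthomorphism:
    (∀ T : E → E, IsLinearMap ℝ T → IsOrdBdd T →
      ((∀ (S : Z) (x : E), T (ρ S x) = ρ S (T x)) ↔ IsOrtho T)) ∧
    -- the commutant of `Z(E)` in `L_b(E)` is `Orth(E)`:
    {T : E → E | IsLinearMap ℝ T ∧ IsOrdBdd T ∧ ∀ (S : Z) (x : E), T (ρ S x) = ρ S (T x)}
      = {T : E → E | IsOrtho T} := by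
  have harch := hD.isArchimedeanRiesz hsep
  have key : ∀ T : E → E, IsLinearMap ℝ T → IsOrdBdd T →
      ((∀ (S : Z) (x : E), T (ρ S x) = ρ S (T x)) ↔ IsOrtho T) := by
    refine fun T hlin hb =>
      ⟨fun h => ⟨hlin, hb, hD.isBandPres_of_commute hsep hZ htf hlin hb h⟩, fun h S x => ?_⟩
    obtain ⟨c, hc, hS⟩ := (hZ.central S).exists_abs_le
    exact IsBandPres.commute harch (S := (hZ.central S).1.1.mk' _) (T := hlin.mk' T) hc hS
      (hZ.central S).1.2.2 h.2.2 hb x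
  refine ⟨key, Set.ext fun T => ⟨fun h => (key T h.1 h.2.1).1 h.2.2, fun h => ?_⟩⟩
  exact ⟨h.1, h.2.1, (key T h.1 h.2.1).2 h⟩
end

section
/- Let E be a Riesz space with point separating order dual and topologically full center. Then the following are equivalent: (1) E^{~~} = (E^~)_n^~, i.e. every order bounded linear functional on E^~ is order continuous; (2) the Arens homomorphism m : Z(E)'' → Z(E^~) is continuous when Z(E)'' carries the σ(Z(E)'',Z(E)')-topology and Z(E^~) carries the σ(E^~,E^{~~})-operator topology. -/
section RieszSpace

variable {E : Type*} [Lattice E] [AddCommGroup E] [IsOrderedAddMonoid E]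

theorem posPart_sub_eq_sub_inf (p q : E) : (p - q)⁺ = p - p ⊓ q := by
  rw [posPart_def, sub_inf, sub_self, sup_comm]

theorem add_inf_le_inf_add {a d n : E} (hd : 0 ≤ d) : (a + d) ⊓ n ≤ a ⊓ n + d := by
  rw [inf_add]
  exact inf_le_inf le_rfl (le_add_of_nonneg_right hd)

variable [Module ℝ E]

/-- A positively homogeneous additive function on the positive cone extends linearly. -/
theorem exists_linearMap_eq_on_nonneg [IsOrderedModule ℝ E] (ψ : E → ℝ)
    (hadd : ∀ x y, 0 ≤ x → 0 ≤ y → ψ (x + y) = ψ x + ψ y)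
    (hsmul : ∀ (c : ℝ) x, 0 < c → 0 ≤ x → ψ (c • x) = c * ψ x) :
    ∃ φ : E →ₗ[ℝ] ℝ, ∀ x, 0 ≤ x → φ x = ψ x := by
  have h0 : ψ 0 = 0 := by simpa using hadd 0 0 le_rfl le_rfl
  have key : ∀ a b : E, 0 ≤ a → 0 ≤ b → ψ (a - b)⁺ - ψ (a - b)⁻ = ψ a - ψ b := by
    intro a b ha hb
    have h1 : (a - b)⁺ + b = a + (a - b)⁻ := by
      have := posPart_sub_negPart (a - b)
      rw [sub_eq_sub_iff_add_eq_add] at this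
      rw [this]
    have h2 := hadd _ _ (posPart_nonneg (a - b)) hb
    rw [h1, hadd _ _ ha (negPart_nonneg _)] at h2
    linarith
  have split : ∀ x : E, x = x⁺ - x⁻ := fun x => (posPart_sub_negPart x).symm
  have hpos : ∀ (c : ℝ) x, 0 ≤ c → 0 ≤ x → ψ (c • x) = c * ψ x := by
    intro c x hc hx
    rcases hc.eq_or_lt with rfl | hc
    · simp [h0]
    · exact hsmul c x hc hx
  refine ⟨{ toFun := fun x => ψ x⁺ - ψ x⁻, map_add' := ?_, map_smul' := ?_ }, ?_⟩
  · intro x y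
    have : x + y = (x⁺ + y⁺) - (x⁻ + y⁻) := by
      conv_lhs => rw [split x, split y]
      abel
    rw [this, key _ _ (add_nonneg (posPart_nonneg _) (posPart_nonneg _))
      (add_nonneg (negPart_nonneg _) (negPart_nonneg _)),
      hadd _ _ (posPart_nonneg _) (posPart_nonneg _),
      hadd _ _ (negPart_nonneg _) (negPart_nonneg _)]
    ring
  · intro c x
    simp only [RingHom.id_apply, smul_eq_mul]
    rcases le_total 0 c with hc | hc
    · have : c • x = c • x⁺ - c • x⁻ := by rw [← smul_sub, ← split]
      rw [this, key _ _ (smul_nonneg hc (posPart_nonneg _)) (smul_nonneg hc (negPart_nonneg _)),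
        hpos _ _ hc (posPart_nonneg _), hpos _ _ hc (negPart_nonneg _)]
      ring
    · have hc' : 0 ≤ -c := by linarith
      have : c • x = (-c) • x⁻ - (-c) • x⁺ := by
        rw [← smul_sub, neg_smul, ← smul_neg, neg_sub, ← split]
      rw [this, key _ _ (smul_nonneg hc' (negPart_nonneg _)) (smul_nonneg hc' (posPart_nonneg _)),
        hpos _ _ hc' (posPart_nonneg _), hpos _ _ hc' (negPart_nonneg _)]
      ring
  · intro x hx
    simp [posPart_of_nonneg hx, negPart_of_nonneg hx, h0]

end RieszSpace

namespace IsOrderDual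

variable {E D : Type*} [Lattice E] [AddCommGroup E] [Module ℝ E]
  [Lattice D] [AddCommGroup D] [Module ℝ D] {P : D →ₗ[ℝ] E →ₗ[ℝ] ℝ}

theorem nonneg_iff (hP : IsOrderDual E D fun f x => P f x) {f : D} :
    0 ≤ f ↔ ∀ x, 0 ≤ x → 0 ≤ P f x := by
  simpa using hP.le_iff 0 f

theorem mono_left (hP : IsOrderDual E D fun f x => P f x) {f g : D} (hfg : f ≤ g) {x : E}
    (hx : 0 ≤ x) : P f x ≤ P g x :=
  (hP.le_iff f g).1 hfg x hx

theorem apply_nonneg (hP : IsOrderDual E D fun f x => P f x) {f : D} (hf : 0 ≤ f) {x : E}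
    (hx : 0 ≤ x) : 0 ≤ P f x :=
  hP.nonneg_iff.1 hf x hx

variable [IsOrderedAddMonoid E]

theorem mono_right (hP : IsOrderDual E D fun f x => P f x) {f : D} (hf : 0 ≤ f) {x y : E}
    (hxy : x ≤ y) : P f x ≤ P f y := by
  have := hP.apply_nonneg hf (sub_nonneg.2 hxy)
  rw [map_sub] at this
  linarith

/-- Every positive linear functional is realized in the order dual. -/
theorem exists_of_nonneg (hP : IsOrderDual E D fun f x => P f x) (φ : E →ₗ[ℝ] ℝ)
    (hφ : ∀ x, 0 ≤ x → 0 ≤ φ x) : ∃ d : D, 0 ≤ d ∧ ∀ x, P d x = φ x := by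
  have hmono : ∀ x y, x ≤ y → φ x ≤ φ y := fun x y hxy => by
    have := hφ _ (sub_nonneg.2 hxy)
    rw [map_sub] at this
    linarith
  obtain ⟨d, hd⟩ := hP.surj φ φ.isLinear fun a b =>
    ⟨φ a, φ b, fun x hax hxb => ⟨hmono _ _ hax, hmono _ _ hxb⟩⟩
  exact ⟨d, hP.nonneg_iff.2 fun x hx => (hφ x hx).trans_eq (hd x).symm, hd⟩

/-- A linear functional dominated by a positive one is realized in the order dual. -/
theorem exists_of_le_abs (hP : IsOrderDual E D fun f x => P f x) {f : D} (hf : 0 ≤ f)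
    (φ : E →ₗ[ℝ] ℝ) (hφ : ∀ x, φ x ≤ P f |x|) : ∃ d : D, ∀ x, P d x = φ x := by
  refine hP.surj φ φ.isLinear fun a b => ⟨-P f (|a| ⊔ |b|), P f (|a| ⊔ |b|), fun x hax hxb => ?_⟩
  have hx : |x| ≤ |a| ⊔ |b| := by
    refine abs_le'.2 ⟨hxb.trans ((le_abs_self b).trans le_sup_right), ?_⟩
    exact (neg_le_neg hax).trans ((neg_le_abs a).trans le_sup_left)
  have h := hP.mono_right hf hx
  have h1 := hφ x
  have h2 := hφ (-x)
  rw [abs_neg, map_neg] at h2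
  constructor <;> linarith

variable [IsOrderedModule ℝ E]

/-- One half of the Riesz–Kantorovich formula for the positive part of a functional. -/
theorem posPart_apply_le (hP : IsOrderDual E D fun f x => P f x) (h : D) {y : E} (hy : 0 ≤ y)
    {c : ℝ} (hc : ∀ u, 0 ≤ u → u ≤ y → P h u ≤ c) : P h⁺ y ≤ c := by
  set A : E → Set ℝ := fun x => (fun u => P h u) '' Set.Icc 0 x with hA
  have hne : ∀ x, 0 ≤ x → (A x).Nonempty := fun x hx => ⟨_, 0, ⟨le_rfl, hx⟩, rfl⟩
  have hbdd : ∀ x, BddAbove (A x) := by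
    intro x
    obtain ⟨c, d, hcd⟩ := hP.bdd h 0 x
    refine ⟨d, ?_⟩
    rintro _ ⟨u, hu, rfl⟩
    exact (hcd u hu.1 hu.2).2
  have hle : ∀ x u, 0 ≤ u → u ≤ x → P h u ≤ sSup (A x) := fun x u h0 hu =>
    le_csSup (hbdd x) ⟨u, ⟨h0, hu⟩, rfl⟩
  have hsup : ∀ x c, 0 ≤ x → (∀ u, 0 ≤ u → u ≤ x → P h u ≤ c) → sSup (A x) ≤ c := by
    intro x c hx H
    refine csSup_le (hne x hx) ?_
    rintro _ ⟨u, hu, rfl⟩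
    exact H u hu.1 hu.2
  have hsm : ∀ (c : ℝ) x, 0 < c → 0 ≤ x → c * sSup (A x) ≤ sSup (A (c • x)) := by
    intro c x hc hx
    rw [← le_div_iff₀' hc]
    refine hsup _ _ hx fun u h0 hu => ?_
    rw [le_div_iff₀' hc]
    simpa using hle (c • x) (c • u) (smul_nonneg hc.le h0) (smul_le_smul_of_nonneg_left hu hc.le)
  have hadd : ∀ x y, 0 ≤ x → 0 ≤ y → sSup (A (x + y)) = sSup (A x) + sSup (A y) := by
    intro x y hx hy
    refine le_antisymm (hsup _ _ (add_nonneg hx hy) fun u h0 hu => ?_) ?_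
    · have h1 := hle x (u ⊓ x) (le_inf h0 hx) inf_le_right
      have h2 := hle y (u - u ⊓ x) (sub_nonneg.2 inf_le_left) (by
        rw [← posPart_sub_eq_sub_inf]
        exact sup_le (sub_le_iff_le_add'.2 hu) hy)
      rw [map_sub] at h2
      linarith
    · rw [← le_sub_iff_add_le]
      refine hsup _ _ hx fun u hu0 hu => ?_
      rw [le_sub_comm]
      refine hsup _ _ hy fun v hv0 hv => ?_
      have := hle (x + y) (u + v) (add_nonneg hu0 hv0) (add_le_add hu hv)
      rw [map_add] at this
      linarith
  have hsmul : ∀ (c : ℝ) x, 0 < c → 0 ≤ x → sSup (A (c • x)) = c * sSup (A x) := by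
    intro c x hc hx
    refine le_antisymm ?_ (hsm c x hc hx)
    have := hsm c⁻¹ (c • x) (inv_pos.2 hc) (smul_nonneg hc.le hx)
    rw [inv_smul_smul₀ hc.ne'] at this
    rwa [inv_mul_le_iff₀ hc] at this
  obtain ⟨φ, hφ⟩ := exists_linearMap_eq_on_nonneg (fun x => sSup (A x)) hadd hsmul
  have hφ0 : ∀ x, 0 ≤ x → 0 ≤ φ x := fun x hx => by
    rw [hφ x hx]
    simpa using hle x 0 le_rfl hx
  obtain ⟨d, hd0, hd⟩ := hP.exists_of_nonneg φ hφ0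
  have hhd : h⁺ ≤ d := by
    refine sup_le ((hP.le_iff _ _).2 fun x hx => ?_) hd0
    rw [hd, hφ x hx]
    exact hle x x hx le_rfl
  refine (hP.mono_left hhd hy).trans ?_
  rw [hd, hφ y hy]
  exact hsup y c hy hc

/-- Suprema of bounded upward directed sets of positive functionals exist and are computed
pointwise. -/
theorem exists_isLUB (hP : IsOrderDual E D fun f x => P f x) {s : Set D} (hne : s.Nonempty)
    (hdir : DirectedOn (· ≤ ·) s) {f : D} (hs : ∀ h ∈ s, 0 ≤ h ∧ h ≤ f) :
    ∃ d : D, IsLUB s d ∧ ∀ x, 0 ≤ x → ∀ c, (∀ h ∈ s, P h x ≤ c) → P d x ≤ c := by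
  set A : E → Set ℝ := fun x => (fun h => P h x) '' s with hA
  have hbdd : ∀ x, 0 ≤ x → BddAbove (A x) := by
    intro x hx
    refine ⟨P f x, ?_⟩
    rintro _ ⟨h, hh, rfl⟩
    exact hP.mono_left (hs h hh).2 hx
  have hle : ∀ x h, 0 ≤ x → h ∈ s → P h x ≤ sSup (A x) := fun x h hx hh =>
    le_csSup (hbdd x hx) ⟨h, hh, rfl⟩
  have hsup : ∀ x c, (∀ h ∈ s, P h x ≤ c) → sSup (A x) ≤ c := by
    intro x c H
    refine csSup_le (hne.image _) ?_
    rintro _ ⟨h, hh, rfl⟩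
    exact H h hh
  have hadd : ∀ x y, 0 ≤ x → 0 ≤ y → sSup (A (x + y)) = sSup (A x) + sSup (A y) := by
    intro x y hx hy
    refine le_antisymm (hsup _ _ fun h hh => ?_) ?_
    · rw [map_add]
      exact add_le_add (hle x h hx hh) (hle y h hy hh)
    · rw [← le_sub_iff_add_le]
      refine hsup _ _ fun h hh => ?_
      rw [le_sub_comm]
      refine hsup _ _ fun k hk => ?_
      obtain ⟨l, hl, hhl, hkl⟩ := hdir h hh k hk
      have h1 := hle (x + y) l (add_nonneg hx hy) hl
      have h2 := hP.mono_left hhl hx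
      have h3 := hP.mono_left hkl hy
      rw [map_add] at h1
      linarith
  have hsmul : ∀ (c : ℝ) x, 0 < c → 0 ≤ x → sSup (A (c • x)) = c * sSup (A x) := by
    intro c x hc hx
    refine le_antisymm (hsup _ _ fun h hh => ?_) ?_
    · rw [map_smul, smul_eq_mul]
      exact mul_le_mul_of_nonneg_left (hle x h hx hh) hc.le
    · rw [← le_div_iff₀' hc]
      refine hsup _ _ fun h hh => ?_
      rw [le_div_iff₀' hc]
      simpa using hle (c • x) h (smul_nonneg hc.le hx) hh
  obtain ⟨φ, hφ⟩ := exists_linearMap_eq_on_nonneg (fun x => sSup (A x)) hadd hsmul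
  have hφ0 : ∀ x, 0 ≤ x → 0 ≤ φ x := fun x hx => by
    rw [hφ x hx]
    obtain ⟨h, hh⟩ := hne
    exact (hP.apply_nonneg (hs h hh).1 hx).trans (hle x h hx hh)
  obtain ⟨d, hd0, hd⟩ := hP.exists_of_nonneg φ hφ0
  have hdle : ∀ x, 0 ≤ x → ∀ c, (∀ h ∈ s, P h x ≤ c) → P d x ≤ c := by
    intro x hx c hc
    rw [hd, hφ x hx]
    exact hsup x c hc
  refine ⟨d, ⟨fun h hh => (hP.le_iff _ _).2 fun x hx => ?_, fun b hb =>
    (hP.le_iff _ _).2 fun x hx => hdle x hx _ fun h hh => hP.mono_left (hb hh) hx⟩, hdle⟩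
  rw [hd, hφ x hx]
  exact hle x h hx hh

end IsOrderDual

namespace IsOrderDual

variable {E D : Type*} [Lattice E] [AddCommGroup E] [IsOrderedAddMonoid E] [Module ℝ E]
  [Lattice D] [AddCommGroup D] [IsOrderedAddMonoid D] [Module ℝ D] {P : D →ₗ[ℝ] E →ₗ[ℝ] ℝ}

/-- A Riesz space whose order dual separates points is Archimedean. -/
theorem eq_zero_of_nsmul_le (hP : IsOrderDual E D fun f x => P f x)
    (hsep : SepPoints fun f x => P f x) {u x : E} (hu : 0 ≤ u) (h : ∀ n : ℕ, n • u ≤ x) :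
    u = 0 := by
  have key : ∀ f : D, 0 ≤ f → P f u = 0 := by
    intro f hf
    refine le_antisymm ?_ (hP.apply_nonneg hf hu)
    by_contra! hpos
    obtain ⟨n, hn⟩ := exists_nat_gt (P f x / P f u)
    rw [div_lt_iff₀ hpos] at hn
    have := hP.mono_right hf (h n)
    rw [map_nsmul, nsmul_eq_mul] at this
    linarith
  refine hsep u fun f => ?_
  dsimp only
  rw [← posPart_sub_negPart f, map_sub, LinearMap.sub_apply, key _ (posPart_nonneg f),
    key _ (negPart_nonneg f), sub_zero]

omit [IsOrderedAddMonoid D] in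
theorem abs_apply_le_of_le [IsOrderedModule ℝ E] (hP : IsOrderDual E D fun f x => P f x) (h : D)
    {y : E} (hy : 0 ≤ y) {c : ℝ} (hc : ∀ u, 0 ≤ u → u ≤ y → |P h u| ≤ c) :
    P h⁺ y ≤ c ∧ P h⁻ y ≤ c := by
  refine ⟨hP.posPart_apply_le h hy fun u h0 hu => (abs_le.1 (hc u h0 hu)).2, ?_⟩
  rw [← posPart_neg]
  refine hP.posPart_apply_le (-h) hy fun u h0 hu => ?_
  have := (abs_le.1 (hc u h0 hu)).1
  rw [map_neg, LinearMap.neg_apply]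
  linarith

end IsOrderDual

namespace IsCenterOf

variable {E Z : Type*} [Lattice E] [AddCommGroup E] [IsOrderedAddMonoid E] [Module ℝ E]
  [Lattice Z] [NormedRing Z] [NormedAlgebra ℝ Z] {R : Z →ₗ[ℝ] E →ₗ[ℝ] E}

omit [IsOrderedAddMonoid E] in
theorem nonneg_iff (hZ : IsCenterOf E Z fun a x => R a x) {a : Z} :
    0 ≤ a ↔ ∀ x, 0 ≤ x → 0 ≤ R a x := by
  simpa using hZ.le_iff 0 a

omit [IsOrderedAddMonoid E] in
theorem map_mul_apply (hZ : IsCenterOf E Z fun a x => R a x) (a b : Z) (x : E) :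
    R (a * b) x = R a (R b x) :=
  hZ.map_mul a b x

omit [IsOrderedAddMonoid E] in
theorem map_one_apply (hZ : IsCenterOf E Z fun a x => R a x) (x : E) : R 1 x = x :=
  hZ.map_one x

omit [IsOrderedAddMonoid E] in
theorem zero_le_one (hZ : IsCenterOf E Z fun a x => R a x) : (0 : Z) ≤ 1 :=
  hZ.nonneg_iff.2 fun x hx => by rwa [hZ.map_one_apply]

omit [IsOrderedAddMonoid E] in
theorem mul_nonneg (hZ : IsCenterOf E Z fun a x => R a x) {a b : Z} (ha : 0 ≤ a) (hb : 0 ≤ b) :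
    0 ≤ a * b :=
  hZ.nonneg_iff.2 fun x hx => by
    rw [hZ.map_mul_apply]
    exact hZ.nonneg_iff.1 ha _ (hZ.nonneg_iff.1 hb x hx)

theorem mono_right (hZ : IsCenterOf E Z fun a x => R a x) {a : Z} (ha : 0 ≤ a) {x y : E}
    (hxy : x ≤ y) : R a x ≤ R a y := by
  have := hZ.nonneg_iff.1 ha _ (sub_nonneg.2 hxy)
  rwa [map_sub, sub_nonneg] at this

omit [IsOrderedAddMonoid E] in
theorem norm_le_iff_abs (hZ : IsCenterOf E Z fun a x => R a x) {a : Z} {c : ℝ} (hc : 0 ≤ c) :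
    ‖a‖ ≤ c ↔ -(c • (1 : Z)) ≤ a ∧ a ≤ c • (1 : Z) := by
  rw [hZ.norm_le_iff a c hc, hZ.le_iff, hZ.le_iff]
  simp only [map_neg, map_smul, LinearMap.neg_apply, LinearMap.smul_apply, hZ.map_one_apply]
  exact ⟨fun h => ⟨fun x hx => (h x hx).1, fun x hx => (h x hx).2⟩,
    fun h x hx => ⟨h.1 x hx, h.2 x hx⟩⟩

variable [IsOrderedAddMonoid Z] [IsOrderedModule ℝ Z]

omit [IsOrderedAddMonoid E] in
theorem mul_eq_zero_of_inf_eq_zero (hZ : IsCenterOf E Z fun a x => R a x) {a b : Z}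
    (hab : a ⊓ b = 0) : a * b = 0 := by
  have ha : 0 ≤ a := hab ▸ inf_le_left
  have hb : 0 ≤ b := hab ▸ inf_le_right
  set c : ℝ := ‖a‖ + ‖b‖ + 1 with hc
  have hc0 : 0 < c := by positivity
  have hac : a ≤ c • (1 : Z) := ((hZ.norm_le_iff_abs hc0.le).1 (by linarith [norm_nonneg b])).2
  have hbc : b ≤ c • (1 : Z) := ((hZ.norm_le_iff_abs hc0.le).1 (by linarith [norm_nonneg a])).2
  have h1 : a * b ≤ c • a := by
    have := hZ.mul_nonneg ha (sub_nonneg.2 hbc)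
    rwa [mul_sub, mul_smul_comm, mul_one, sub_nonneg] at this
  have h2 : a * b ≤ c • b := by
    have := hZ.mul_nonneg (sub_nonneg.2 hac) hb
    rwa [sub_mul, smul_mul_assoc, one_mul, sub_nonneg] at this
  have h3 : c⁻¹ • (a * b) ≤ 0 := by
    rw [← hab]
    refine le_inf ?_ ?_
    · simpa [inv_smul_smul₀ hc0.ne'] using smul_le_smul_of_nonneg_left h1 (inv_nonneg.2 hc0.le)
    · simpa [inv_smul_smul₀ hc0.ne'] using smul_le_smul_of_nonneg_left h2 (inv_nonneg.2 hc0.le)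
  refine le_antisymm ?_ (hZ.mul_nonneg ha hb)
  simpa [smul_inv_smul₀ hc0.ne'] using smul_le_smul_of_nonneg_left h3 hc0.le

omit [IsOrderedAddMonoid E] in
theorem mul_self_nonneg (hZ : IsCenterOf E Z fun a x => R a x) (a : Z) : 0 ≤ a * a := by
  have h1 : a⁺ * a⁻ = 0 := hZ.mul_eq_zero_of_inf_eq_zero (posPart_inf_negPart_eq_zero a)
  have h2 : a⁻ * a⁺ = 0 := hZ.mul_eq_zero_of_inf_eq_zero
    (by rw [inf_comm, posPart_inf_negPart_eq_zero])
  have : a * a = a⁺ * a⁺ + a⁻ * a⁻ := by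
    conv_lhs => rw [← posPart_sub_negPart a]
    rw [sub_mul, mul_sub, mul_sub, h1, h2]
    abel
  rw [this]
  exact add_nonneg (hZ.mul_nonneg (posPart_nonneg a) (posPart_nonneg a))
    (hZ.mul_nonneg (negPart_nonneg a) (negPart_nonneg a))

omit [IsOrderedAddMonoid E] [IsOrderedModule ℝ Z] in
theorem mul_self_le (hZ : IsCenterOf E Z fun a x => R a x) (a : Z) :
    a * a ≤ (‖a‖ ^ 2) • (1 : Z) := by
  obtain ⟨h1, h2⟩ := (hZ.norm_le_iff_abs (norm_nonneg a)).1 le_rfl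
  have := hZ.mul_nonneg (sub_nonneg.2 h2) (neg_le_iff_add_nonneg.1 h1)
  rw [sub_mul, mul_add, mul_add] at this
  simp only [smul_mul_assoc, one_mul, mul_smul_comm, mul_one, smul_smul] at this
  rw [← sub_nonneg, sq]
  convert this using 1
  abel

/-- The positive part in the center acts pointwise on the positive cone. -/
theorem posPart_apply (hZ : IsCenterOf E Z fun a x => R a x)
    (harch : ∀ u x : E, 0 ≤ u → (∀ n : ℕ, n • u ≤ x) → u = 0)
    [IsOrderedModule ℝ E] (a : Z) {x : E} (hx : 0 ≤ x) :
    R a⁺ x = (R a x)⁺ := by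
  have hp0 := posPart_nonneg a
  have hn0 := negPart_nonneg a
  set p := a⁺ with hp
  set n := a⁻ with hn
  have hpn : p * n = 0 := hZ.mul_eq_zero_of_inf_eq_zero (posPart_inf_negPart_eq_zero a)
  obtain ⟨c, hc0, hpc⟩ : ∃ c : ℝ, 0 < c ∧ p ≤ c • (1 : Z) :=
    ⟨‖p‖ + 1, by positivity, ((hZ.norm_le_iff_abs (by positivity)).1 (by linarith)).2⟩
  have hdisj : R p x ⊓ R n x = 0 := by
    set u := R p x ⊓ R n x with hu
    have hu0 : 0 ≤ u := le_inf (hZ.nonneg_iff.1 hp0 x hx) (hZ.nonneg_iff.1 hn0 x hx)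
    have hpu : R p u = 0 := by
      refine le_antisymm ?_ (hZ.nonneg_iff.1 hp0 u hu0)
      have := hZ.mono_right hp0 (inf_le_right : u ≤ R n x)
      rwa [← hZ.map_mul_apply, hpn, map_zero, LinearMap.zero_apply] at this
    refine harch u (c • x) hu0 fun k => ?_
    induction k with
    | zero => simpa using smul_nonneg hc0.le hx
    | succ k ih =>
      have h1 : u ≤ R p (x - c⁻¹ • k • u) := by
        rw [map_sub, map_smul, map_nsmul, hpu, smul_zero, smul_zero, sub_zero]
        exact inf_le_left
      have h2 : c⁻¹ • k • u ≤ x := by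
        simpa [inv_smul_smul₀ hc0.ne'] using smul_le_smul_of_nonneg_left ih (inv_nonneg.2 hc0.le)
      have h3 := (hZ.le_iff _ _).1 hpc _ (sub_nonneg.2 h2)
      rw [map_smul, LinearMap.smul_apply, hZ.map_one_apply, smul_sub, smul_inv_smul₀ hc0.ne'] at h3
      rw [succ_nsmul, add_comm]
      exact le_sub_iff_add_le.1 (h1.trans h3)
  have : R a x = R p x - R n x := by
    rw [← LinearMap.sub_apply, ← map_sub, posPart_sub_negPart]
  rw [this, posPart_sub_eq_sub_inf, hdisj, sub_zero]

/-- Truncating an element of the center to the interval `[0, 1]`. -/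
theorem exists_truncation (hZ : IsCenterOf E Z fun a x => R a x)
    (harch : ∀ u x : E, 0 ≤ u → (∀ n : ℕ, n • u ≤ x) → u = 0)
    [IsOrderedModule ℝ E] (a : Z) {x v : E} (hv : 0 ≤ v) (hvx : v ≤ x) :
    ∃ b : Z, 0 ≤ b ∧ b ≤ 1 ∧ |R b x - v| ≤ |R a x - v| := by
  have hx : 0 ≤ x := hv.trans hvx
  refine ⟨a⁺ ⊓ 1, le_inf (posPart_nonneg a) hZ.zero_le_one, inf_le_right, ?_⟩
  have h1 : R (a⁺ ⊓ 1) x = (R a x)⁺ ⊓ x := by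
    have : a⁺ ⊓ 1 = a⁺ - (a⁺ - 1)⁺ := by rw [posPart_sub_eq_sub_inf, sub_sub_cancel]
    rw [this, map_sub, LinearMap.sub_apply, hZ.posPart_apply harch _ hx,
      hZ.posPart_apply harch _ hx, map_sub R, LinearMap.sub_apply, hZ.posPart_apply harch _ hx,
      hZ.map_one_apply, posPart_sub_eq_sub_inf, sub_sub_cancel]
  have h2 : v = v⁺ ⊓ x := by rw [posPart_of_nonneg hv, inf_eq_left.2 hvx]
  rw [h1]
  conv_lhs => rw [h2]
  exact (abs_inf_sub_inf_le_abs _ _ _).trans (abs_sup_sub_sup_le_abs _ _ _)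

omit [IsOrderedAddMonoid Z] [IsOrderedModule ℝ Z] in
theorem abs_apply_apply_le {D : Type*} [Lattice D] [AddCommGroup D] [Module ℝ D]
    {P : D →ₗ[ℝ] E →ₗ[ℝ] ℝ} (hZ : IsCenterOf E Z fun a x => R a x)
    (hP : IsOrderDual E D fun f x => P f x) {f : D} (hf : 0 ≤ f) (a : Z) (x : E) :
    |P f (R a x)| ≤ P f |x| * ‖a‖ := by
  have key : ∀ y, 0 ≤ y → |P f (R a y)| ≤ ‖a‖ * P f y := by
    intro y hy
    obtain ⟨h1, h2⟩ := (hZ.norm_le_iff a ‖a‖ (norm_nonneg a)).1 le_rfl y hy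
    have h1 := hP.mono_right hf h1
    have h2 := hP.mono_right hf h2
    rw [map_neg, map_smul, smul_eq_mul] at h1
    rw [map_smul, smul_eq_mul] at h2
    exact abs_le.2 ⟨h1, h2⟩
  have h1 := key _ (posPart_nonneg x)
  have h2 := key _ (negPart_nonneg x)
  rw [← posPart_add_negPart x, map_add]
  conv_lhs => rw [← posPart_sub_negPart x]
  rw [map_sub, map_sub]
  refine (abs_sub _ _).trans ?_
  linarith

end IsCenterOf

/-- Riesz representation up to an error: a functional bounded by the seminorm of a positive
semidefinite form is nearly represented by a vector. -/
theorem LinearMap.BilinForm.exists_abs_sub_le {V : Type*} [AddCommGroup V] [Module ℝ V]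
    (B : LinearMap.BilinForm ℝ V) (hsymm : ∀ v w, B v w = B w v) (hpos : ∀ v, 0 ≤ B v v)
    (l : V →ₗ[ℝ] ℝ) (C : ℝ) (hl : ∀ v, |l v| ≤ C * √(B v v)) {η : ℝ} (hη : 0 < η) :
    ∃ v, ∀ w, |B v w - l w| ≤ η * √(B w w) := by
  set J : V → ℝ := fun v => B v v - 2 * l v with hJ
  have hbdd : BddBelow (Set.range J) := by
    refine ⟨-C ^ 2, ?_⟩
    rintro _ ⟨v, rfl⟩
    have h1 := (abs_le.1 (hl v)).2
    have h2 := Real.sq_sqrt (hpos v)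
    simp only [hJ]
    nlinarith [sq_nonneg (√(B v v) - C)]
  obtain ⟨_, ⟨v, rfl⟩, hv⟩ := exists_lt_of_csInf_lt (Set.range_nonempty J)
    (lt_add_of_pos_right (sInf (Set.range J)) (pow_pos hη 2))
  refine ⟨v, fun w => ?_⟩
  have hquad : ∀ t : ℝ, 0 ≤ B w w * (t * t) + (2 * (B v w - l w)) * t + η ^ 2 := by
    intro t
    have h := csInf_le hbdd ⟨v + t • w, rfl⟩
    simp only [hJ, map_add, map_smul, LinearMap.add_apply, LinearMap.smul_apply, smul_eq_mul,
      hsymm w v] at h hv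
    linarith
  have hd := discrim_le_zero hquad
  rw [discrim] at hd
  refine abs_le_of_sq_le_sq ?_ (by positivity)
  rw [mul_pow, Real.sq_sqrt (hpos w)]
  linarith

namespace IsCenterOf

variable {E Z : Type*} [Lattice E] [AddCommGroup E] [Module ℝ E]
  [Lattice Z] [NormedRing Z] [NormedAlgebra ℝ Z] {R : Z →ₗ[ℝ] E →ₗ[ℝ] E}
  [IsOrderedAddMonoid Z]

theorem abs_le_of_dualNonneg (hZ : IsCenterOf E Z fun a x => R a x) (κ : Z →ₗ[ℝ] ℝ)
    (hκ : ∀ a, 0 ≤ a → 0 ≤ κ a) (a : Z) : |κ a| ≤ κ 1 * ‖a‖ := by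
  obtain ⟨h1, h2⟩ := (hZ.norm_le_iff_abs (norm_nonneg a)).1 le_rfl
  have h1 := hκ _ (neg_le_iff_add_nonneg.1 h1)
  have h2 := hκ _ (sub_nonneg.2 h2)
  rw [map_add, map_smul, smul_eq_mul] at h1
  rw [map_sub, map_smul, smul_eq_mul] at h2
  rw [abs_le]
  constructor <;> linarith

variable [IsOrderedModule ℝ Z]

theorem sq_symm_le (hZ : IsCenterOf E Z fun a x => R a x) (κ : Z →ₗ[ℝ] ℝ)
    (hκ : ∀ a, 0 ≤ a → 0 ≤ κ a) (a b : Z) :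
    (κ (a * b + b * a) / 2) ^ 2 ≤ κ (a * a) * κ (b * b) := by
  have hquad : ∀ t : ℝ, 0 ≤ κ (a * a) * (t * t) + κ (a * b + b * a) * t + κ (b * b) := by
    intro t
    have h := hκ _ (hZ.mul_self_nonneg (t • a + b))
    have : (t • a + b) * (t • a + b) = (t * t) • (a * a) + t • (a * b + b * a) + b * b := by
      simp only [add_mul, mul_add, smul_mul_assoc, mul_smul_comm, smul_smul, smul_add]
      abel
    rw [this] at h
    simp only [map_add, map_smul, smul_eq_mul] at h ⊢
    linarith
  have hd := discrim_le_zero hquad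
  rw [discrim] at hd
  linarith

/-- On the order interval `[0, lam]` of the dual of the center, every functional of the bidual
is a uniform limit of elements of the center. -/
theorem exists_uniform_approx (hZ : IsCenterOf E Z fun a x => R a x) (lam : Z →L[ℝ] ℝ)
    (hlam : dualNonneg lam) (F : (Z →L[ℝ] ℝ) →L[ℝ] ℝ) {ε : ℝ} (hε : 0 < ε) :
    ∃ S : Z, ∀ κ : Z →L[ℝ] ℝ, dualNonneg κ → (∀ a, 0 ≤ a → κ a ≤ lam a) →
      |F κ - κ S| ≤ ε := by
  set L : ℝ := lam 1 with hL
  have hL0 : 0 ≤ L := hlam 1 hZ.zero_le_one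
  have hsq0 : ∀ a, 0 ≤ lam (a * a) := fun a => hlam _ (hZ.mul_self_nonneg a)
  have hsq : ∀ a, √(lam (a * a)) ≤ √L * ‖a‖ := by
    intro a
    rw [Real.sqrt_le_iff]
    refine ⟨by positivity, ?_⟩
    have h := hlam _ (sub_nonneg.2 (hZ.mul_self_le a))
    rw [map_sub, map_smul, smul_eq_mul] at h
    rw [mul_pow, Real.sq_sqrt hL0]
    linarith
  set Λ : Z →ₗ[ℝ] Z →L[ℝ] ℝ :=
    { toFun := fun a => (1 / 2 : ℝ) • lam.comp
        (ContinuousLinearMap.mul ℝ Z a + (ContinuousLinearMap.mul ℝ Z).flip a)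
      map_add' := fun a b => by
        ext c
        simp
        ring
      map_smul' := fun t a => by
        ext c
        simp
        ring } with hΛ
  have hΛ_apply : ∀ a b, Λ a b = lam (a * b + b * a) / 2 := by
    intro a b
    simp [hΛ]
    ring
  have hΛ_self : ∀ a, Λ a a = lam (a * a) := by
    intro a
    rw [hΛ_apply, map_add]
    ring
  have hΛ_le : ∀ a b, |Λ a b| ≤ √(lam (a * a)) * √(lam (b * b)) := by
    intro a b
    refine abs_le_of_sq_le_sq ?_ (by positivity)
    rw [mul_pow, Real.sq_sqrt (hsq0 a), Real.sq_sqrt (hsq0 b), hΛ_apply]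
    exact hZ.sq_symm_le lam.toLinearMap hlam a b
  have hΛ_norm : ∀ a, ‖Λ a‖ ≤ √L * √(lam (a * a)) := by
    intro a
    refine ContinuousLinearMap.opNorm_le_bound _ (by positivity) fun b => ?_
    calc ‖Λ a b‖ ≤ √(lam (a * a)) * √(lam (b * b)) := hΛ_le a b
      _ ≤ √(lam (a * a)) * (√L * ‖b‖) := by gcongr; exact hsq b
      _ = _ := by ring
  let B : LinearMap.BilinForm ℝ Z := ContinuousLinearMap.coeLM ℝ ∘ₗ Λ
  have hB : ∀ a b, B a b = Λ a b := fun a b => rfl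
  have hsymm : ∀ a b, B a b = B b a := fun a b => by
    rw [hB, hB, hΛ_apply, hΛ_apply, add_comm]
  have hpos : ∀ a, 0 ≤ B a a := fun a => by
    rw [hB, hΛ_self]
    exact hsq0 a
  have hη : 0 < ε / (2 * (√L + 1)) := by positivity
  obtain ⟨S, hS⟩ := B.exists_abs_sub_le hsymm hpos (F.toLinearMap ∘ₗ Λ) (‖F‖ * √L)
    (fun a => by
      rw [hB, hΛ_self]
      calc |F (Λ a)| ≤ ‖F‖ * ‖Λ a‖ := F.le_opNorm _
        _ ≤ ‖F‖ * (√L * √(lam (a * a))) := by gcongr; exact hΛ_norm a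
        _ = _ := by ring) hη
  refine ⟨S, fun κ hκ hκle => ?_⟩
  have hκ1 : 0 ≤ κ 1 := hκ 1 hZ.zero_le_one
  have hκ_le : ∀ a, |κ a| ≤ √L * √(lam (a * a)) := by
    intro a
    refine abs_le_of_sq_le_sq ?_ (by positivity)
    have h := hZ.sq_symm_le κ.toLinearMap hκ 1 a
    simp only [one_mul, mul_one, ContinuousLinearMap.coe_coe, map_add, add_self_div_two] at h
    rw [mul_pow, Real.sq_sqrt hL0, Real.sq_sqrt (hsq0 a)]
    exact h.trans (mul_le_mul (hκle 1 hZ.zero_le_one) (hκle _ (hZ.mul_self_nonneg a))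
      (hκ _ (hZ.mul_self_nonneg a)) hL0)
  refine le_of_forall_pos_le_add fun δ hδ => ?_
  set K : ℝ := (‖F‖ + ‖S‖) * √L + ε / 2 / (√L + 1) with hK
  have hK0 : 0 ≤ K := by positivity
  set η : ℝ := δ / (K + 1) with hηdef
  have hη0 : 0 < η := by positivity
  obtain ⟨T, hT⟩ := B.exists_abs_sub_le hsymm hpos κ.toLinearMap (√L)
    (fun a => by rw [hB, hΛ_self]; exact hκ_le a) hη0
  have hTκ : ‖Λ T - κ‖ ≤ η * √L := by
    refine ContinuousLinearMap.opNorm_le_bound _ (by positivity) fun b => ?_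
    have h := hT b
    rw [hB, hB, hΛ_self] at h
    calc ‖(Λ T - κ) b‖ ≤ η * √(lam (b * b)) := h
      _ ≤ η * (√L * ‖b‖) := by gcongr; exact hsq b
      _ = _ := by ring
  have hTT : √(lam (T * T)) ≤ √L + η := by
    have h := (abs_le.1 (hT T)).2
    have h' := (abs_le.1 (hκ_le T)).2
    rw [hB, hΛ_self] at h
    have h2 := Real.mul_self_sqrt (hsq0 T)
    simp only [ContinuousLinearMap.coe_coe] at h
    by_contra! hlt
    have : 0 < √(lam (T * T)) := lt_of_le_of_lt (by positivity) hlt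
    nlinarith
  have e1 : |F κ - F (Λ T)| ≤ ‖F‖ * (η * √L) := by
    rw [abs_sub_comm, ← map_sub]
    exact (F.le_opNorm _).trans (by gcongr)
  have e2 : |F (Λ T) - Λ T S| ≤ ε / (2 * (√L + 1)) * (√L + η) := by
    have h := hS T
    rw [hB, hB, hΛ_self, abs_sub_comm, ← hB, hsymm] at h
    exact h.trans (by gcongr)
  have e3 : |Λ T S - κ S| ≤ η * √L * ‖S‖ :=
    ((Λ T - κ).le_opNorm S).trans (by gcongr)
  have e4 : ε / (2 * (√L + 1)) * (√L + η) ≤ ε / 2 + η * (ε / 2 / (√L + 1)) := by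
    have : ε / (2 * (√L + 1)) = ε / 2 / (√L + 1) := by rw [div_div]
    rw [this, mul_add]
    have h5 : ε / 2 / (√L + 1) * √L ≤ ε / 2 := by
      rw [div_mul_eq_mul_div, div_le_iff₀ (by positivity)]
      nlinarith
    linarith
  have e5 : η * K ≤ δ := by
    rw [hηdef, div_mul_eq_mul_div, div_le_iff₀ (by positivity)]
    nlinarith
  have e6 := abs_sub_le (F κ) (F (Λ T)) (κ S)
  have e7 := abs_sub_le (F (Λ T)) (Λ T S) (κ S)
  rw [hK] at e5
  nlinarith

end IsCenterOf

theorem abs_smul_of_pos {E : Type*} [Lattice E] [AddCommGroup E] [IsOrderedAddMonoid E]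
    [Module ℝ E] [IsOrderedModule ℝ E] {c : ℝ} (hc : 0 < c) (x : E) : |c • x| = c • |x| := by
  have key : ∀ (c : ℝ) (x : E), 0 < c → |c • x| ≤ c • |x| := fun c x hc => by
    refine abs_le'.2 ⟨smul_le_smul_of_nonneg_left (le_abs_self x) hc.le, ?_⟩
    rw [← smul_neg]
    exact smul_le_smul_of_nonneg_left (neg_le_abs x) hc.le
  refine (key c x hc).antisymm ?_
  have h := smul_le_smul_of_nonneg_left (key c⁻¹ (c • x) (inv_pos.2 hc)) hc.le
  rwa [inv_smul_smul₀ hc.ne', smul_inv_smul₀ hc.ne'] at h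

namespace TopFullCenter

variable {E D Z : Type*} [Lattice E] [AddCommGroup E] [Module ℝ E]
  [IsOrderedAddMonoid E] [IsOrderedModule ℝ E]
  [Lattice D] [AddCommGroup D] [Module ℝ D]
  [Lattice Z] [NormedRing Z] [NormedAlgebra ℝ Z]
  {P : D →ₗ[ℝ] E →ₗ[ℝ] ℝ} {R : Z →ₗ[ℝ] E →ₗ[ℝ] E}

omit [Lattice Z] in
/-- Topological fullness in the weak topology improves to the absolute weak topology. -/
theorem exists_apply_abs_sub_lt
    (htf : TopFullCenter (fun f x => P f x) fun a x => R a x)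
    (hP : IsOrderDual E D fun f x => P f x) {f : D} (hf : 0 ≤ f) {v w : E} (hv : 0 ≤ v)
    (hvw : v ≤ w) {ε : ℝ} (hε : 0 < ε) : ∃ S : Z, P f |R S w - v| < ε := by
  by_contra! hS
  have hv_mem : v ∉ LinearMap.range (R.flip w) := by
    rintro ⟨S, hSv⟩
    have h := hS S
    rw [LinearMap.flip_apply] at hSv
    rw [hSv, sub_self, abs_zero, map_zero] at h
    exact h.not_gt hε
  obtain ⟨g, hg, hgle⟩ := exists_extension_of_le_sublinear
    (LinearPMap.supSpanSingleton ⟨LinearMap.range (R.flip w), 0⟩ v ε hv_mem)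
    (fun y => P f |y|) (fun c hc y => by rw [abs_smul_of_pos hc, map_smul, smul_eq_mul])
    (fun y z => by
      rw [← map_add]
      exact hP.mono_right hf (abs_add_le y z)) (by
      rintro ⟨y, hy⟩
      obtain ⟨z, hz, _, ht, rfl⟩ := Submodule.mem_sup.1 hy
      obtain ⟨t, rfl⟩ := Submodule.mem_span_singleton.1 ht
      rw [LinearPMap.supSpanSingleton_apply_mk _ _ _ _ _ hz]
      obtain ⟨S, rfl⟩ := hz
      simp only [LinearMap.flip_apply]
      change (0 : ℝ) + t * ε ≤ P f |R S w + t • v|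
      rcases le_or_gt t 0 with ht | ht
      · have := hP.apply_nonneg hf (abs_nonneg (R S w + t • v))
        nlinarith
      · have h := hS (-(t⁻¹ • S))
        have e : R S w + t • v = t • -(R (-(t⁻¹ • S)) w - v) := by
          simp [smul_add, smul_smul, ht.ne', add_comm]
        rw [e, abs_smul_of_pos ht, abs_neg, map_smul, smul_eq_mul]
        nlinarith)
  obtain ⟨k, hk⟩ := hP.exists_of_le_abs hf g hgle
  have hkv : P k v = ε := by
    rw [hk, hg ⟨v, Submodule.mem_sup_right (Submodule.mem_span_singleton_self v)⟩]
    exact LinearPMap.supSpanSingleton_apply_self _ _ _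
  obtain ⟨_, ⟨S, rfl⟩, hz⟩ := htf w (hv.trans hvw) v
    ⟨1, zero_le_one, by rwa [one_smul, abs_of_nonneg hv]⟩ {k} ε hε
  have hkS : P k (R S w) = 0 := by
    have hmem : R S w ∈ LinearMap.range (R.flip w) := ⟨S, rfl⟩
    rw [hk, hg ⟨R S w, Submodule.mem_sup_left hmem⟩,
      LinearPMap.supSpanSingleton_apply_mk_of_mem _ _ _ hmem]
    rfl
  have h := hz k (Finset.mem_singleton_self k)
  simp only [hkS, hkv, zero_sub, abs_neg, abs_of_pos hε] at h
  exact h.false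

variable [IsOrderedAddMonoid D] [IsOrderedAddMonoid Z] [IsOrderedModule ℝ Z]

/-- The value `f x⁺` is almost attained by `f ∘ T` at `x`, for `T` in the interval `[0, 1]` of
the center. -/
theorem exists_apply_posPart_le
    (htf : TopFullCenter (fun f x => P f x) fun a x => R a x)
    (hP : IsOrderDual E D fun f x => P f x) (hsep : SepPoints fun f x => P f x)
    (hZ : IsCenterOf E Z fun a x => R a x) {f : D} (hf : 0 ≤ f) (x : E) {ε : ℝ} (hε : 0 < ε) :
    ∃ T : Z, ‖T‖ ≤ 1 ∧ P f x⁺ ≤ P f (R T x) + ε := by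
  obtain ⟨S, hS⟩ := htf.exists_apply_abs_sub_lt hP hf (posPart_nonneg x)
    (v := x⁺) (w := |x|) (by
      rw [← posPart_add_negPart x]
      exact le_add_of_nonneg_right (negPart_nonneg x)) (ε := ε / 3) (by positivity)
  obtain ⟨T, hT0, hT1, hT⟩ := hZ.exists_truncation
    (fun u x hu h => hP.eq_zero_of_nsmul_le hsep hu h) S (posPart_nonneg x) (x := |x|) (by
      rw [← posPart_add_negPart x]
      exact le_add_of_nonneg_right (negPart_nonneg x))
  have hd : P f |R T |x| - x⁺| < ε / 3 := (hP.mono_right hf hT).trans_lt hS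
  set d := |R T |x| - x⁺| with hddef
  have hd0 : 0 ≤ d := abs_nonneg _
  refine ⟨T, ?_, ?_⟩
  · refine (hZ.norm_le_iff_abs _root_.zero_le_one).2 ?_
    rw [one_smul]
    exact ⟨(neg_nonpos.2 hZ.zero_le_one).trans hT0, hT1⟩
  have hb : R T x⁻ ≤ d := by
    have h1 : R T x⁻ ≤ x⁺ + d := by
      have e : x⁻ ≤ |x| := by
        rw [← posPart_add_negPart x]
        exact le_add_of_nonneg_left (posPart_nonneg x)
      exact (hZ.mono_right hT0 e).trans (sub_le_iff_le_add'.1 (le_abs_self _))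
    have h2 : R T x⁻ ≤ x⁻ := by
      have := (hZ.le_iff _ _).1 hT1 _ (negPart_nonneg x)
      rwa [hZ.map_one_apply] at this
    have h3 := (le_inf h1 h2).trans (add_inf_le_inf_add hd0)
    rwa [posPart_inf_negPart_eq_zero, zero_add] at h3
  have hfb := hP.mono_right hf hb
  have ht : P f x⁺ - P f (R T |x|) ≤ P f d := by
    rw [← map_sub]
    refine hP.mono_right hf ?_
    rw [hddef, abs_sub_comm]
    exact le_abs_self _
  have e : R T x = R T |x| - 2 • R T x⁻ := by
    rw [← map_nsmul, ← map_sub]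
    congr 1
    rw [← posPart_add_negPart x, two_nsmul]
    conv_lhs => rw [← posPart_sub_negPart x]
    abel
  rw [e, map_sub, map_nsmul, two_nsmul]
  linarith

/-- Functionals dominated by `f` arise from `f` through the bidual of the center: if `ν x` is the
functional `T ↦ f (T x)`, then every `0 ≤ g ≤ f` has the form `x ↦ F (ν x)`. -/
theorem exists_bidual_apply_eq
    (htf : TopFullCenter (fun f x => P f x) fun a x => R a x)
    (hP : IsOrderDual E D fun f x => P f x) (hsep : SepPoints fun f x => P f x)
    (hZ : IsCenterOf E Z fun a x => R a x) {f g : D} (hg : 0 ≤ g) (hgf : g ≤ f)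
    (ν : E →ₗ[ℝ] Z →L[ℝ] ℝ) (hν : ∀ x T, ν x T = P f (R T x)) :
    ∃ F : (Z →L[ℝ] ℝ) →L[ℝ] ℝ, ‖F‖ ≤ 1 ∧ ∀ x, F (ν x) = P g x := by
  have hf : 0 ≤ f := hg.trans hgf
  have hle : ∀ x, P g x ≤ ‖ν x‖ := by
    intro x
    refine le_of_forall_pos_le_add fun ε hε => ?_
    obtain ⟨T, hT1, hT⟩ := htf.exists_apply_posPart_le hP hsep hZ hf x hε
    have h1 := hP.mono_right hg (le_posPart x)
    have h2 := hP.mono_left hgf (posPart_nonneg x)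
    have h3 := (le_abs_self _).trans ((ν x).le_of_opNorm_le_of_le le_rfl hT1)
    rw [hν, mul_one] at h3
    linarith
  have habs : ∀ x, |P g x| ≤ ‖ν x‖ := fun x => by
    have := hle (-x)
    rw [map_neg, map_neg, norm_neg] at this
    exact abs_le.2 ⟨by linarith, hle x⟩
  have hker : LinearMap.ker ν ≤ LinearMap.ker (P g) := fun x hx => by
    rw [LinearMap.mem_ker] at hx ⊢
    have := habs x
    rw [hx, norm_zero] at this
    exact abs_nonpos_iff.1 this
  obtain ⟨φ, hφ⟩ : ∃ φ : LinearMap.range ν →ₗ[ℝ] ℝ, ∀ x, φ ⟨ν x, x, rfl⟩ = P g x := by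
    refine ⟨(LinearMap.ker ν).liftQ (P g) hker ∘ₗ ν.quotKerEquivRange.symm, fun x => ?_⟩
    have : (⟨ν x, x, rfl⟩ : LinearMap.range ν) = ν.quotKerEquivRange (Submodule.Quotient.mk x) :=
      rfl
    rw [this, LinearMap.comp_apply, LinearEquiv.coe_coe, LinearEquiv.symm_apply_apply]
    rfl
  obtain ⟨F, hF, hFn⟩ := exists_extension_norm_eq (LinearMap.range ν)
    (φ.mkContinuous 1 (by
      rintro ⟨_, x, rfl⟩
      rw [hφ, one_mul]
      exact habs x))
  refine ⟨F, hFn ▸ LinearMap.mkContinuous_norm_le _ _root_.zero_le_one _, fun x => ?_⟩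
  exact (hF ⟨ν x, x, rfl⟩).trans (hφ x)

end TopFullCenter

namespace IsCenterOf

variable {E D Z : Type*} [Lattice E] [AddCommGroup E] [Module ℝ E]
  [Lattice D] [AddCommGroup D] [Module ℝ D]
  [Lattice Z] [NormedRing Z] [NormedAlgebra ℝ Z]
  {P : D →ₗ[ℝ] E →ₗ[ℝ] ℝ} {R : Z →ₗ[ℝ] E →ₗ[ℝ] E}

/-- The adjoint action of the center on the order dual. -/
theorem exists_adjoint (hZ : IsCenterOf E Z fun a x => R a x)
    (hP : IsOrderDual E D fun f x => P f x) :
    ∃ A : Z →ₗ[ℝ] D →ₗ[ℝ] D, ∀ T f x, P (A T f) x = P f (R T x) := by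
  have h : ∀ (T : Z) (f : D), ∃ g : D, ∀ x, P g x = P f (R T x) := fun T f => by
    refine hP.surj (fun x => P f (R T x)) (P f ∘ₗ R T).isLinear fun a b => ?_
    obtain ⟨c, d, hcd⟩ := (hZ.central T).1.2.1 a b
    obtain ⟨c', d', hcd'⟩ := hP.bdd f c d
    exact ⟨c', d', fun x hax hxb => hcd' _ (hcd x hax hxb).1 (hcd x hax hxb).2⟩
  choose A hA using h
  refine ⟨LinearMap.mk₂ ℝ A ?_ ?_ ?_ ?_, fun T f x => hA T f x⟩
  all_goals
    intros
    refine hP.inj _ _ fun x => ?_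
    simp [hA]

/-- The functionals `T ↦ f (T x)` on the center, as a function of `x`. -/
theorem exists_functional [IsOrderedAddMonoid E] (hZ : IsCenterOf E Z fun a x => R a x)
    (hP : IsOrderDual E D fun f x => P f x) {f : D} (hf : 0 ≤ f) :
    ∃ ν : E →ₗ[ℝ] Z →L[ℝ] ℝ, ∀ x T, ν x T = P f (R T x) :=
  ⟨{ toFun := fun x => (P f ∘ₗ R.flip x).mkContinuous (P f |x|) (hZ.abs_apply_apply_le hP hf · x)
     map_add' := fun x y => by
       ext T
       change P f (R T (x + y)) = P f (R T x) + P f (R T y)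
       simp
     map_smul' := fun c x => by
       ext T
       change P f (R T (c • x)) = c * P f (R T x)
       simp }, fun x T => rfl⟩

end IsCenterOf

theorem IsOrderContinuousFun.sub {X : Type*} [Lattice X] [AddCommGroup X] {φ ψ : X → ℝ}
    (hφ : IsOrderContinuousFun φ) (hψ : IsOrderContinuousFun ψ) :
    IsOrderContinuousFun fun x => φ x - ψ x := by
  intro s hne hdir hs ε hε
  obtain ⟨a, ha, hφa⟩ := hφ s hne hdir hs (ε / 2) (half_pos hε)
  obtain ⟨b, hb, hψb⟩ := hψ s hne hdir hs (ε / 2) (half_pos hε)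
  obtain ⟨c, hc, hca, hcb⟩ := hdir a ha b hb
  refine ⟨c, hc, fun y hy hyc => (abs_sub _ _).trans_lt ?_⟩
  linarith [hφa y hy (hyc.trans hca), hψb y hy (hyc.trans hcb)]

namespace TopFullCenter

variable {E D DD Z : Type*} [Lattice E] [AddCommGroup E] [Module ℝ E]
  [IsOrderedAddMonoid E] [IsOrderedModule ℝ E]
  [Lattice D] [AddCommGroup D] [Module ℝ D] [IsOrderedAddMonoid D]
  [Lattice DD] [AddCommGroup DD] [Module ℝ DD]
  [Lattice Z] [NormedRing Z] [NormedAlgebra ℝ Z] [IsOrderedAddMonoid Z] [IsOrderedModule ℝ Z]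
  {P : D →ₗ[ℝ] E →ₗ[ℝ] ℝ} {Q : DD →ₗ[ℝ] D →ₗ[ℝ] ℝ} {R : Z →ₗ[ℝ] E →ₗ[ℝ] E}

/-- If `F ↦ q (m F f)` is weak* continuous for every `f`, then `q` is order continuous. -/
theorem isOrderContinuousFun_of_continuous
    (htf : TopFullCenter (fun f x => P f x) fun a x => R a x)
    (hP : IsOrderDual E D fun f x => P f x) (hsep : SepPoints fun f x => P f x)
    (hQ : IsOrderDual D DD fun q f => Q q f) (hZ : IsCenterOf E Z fun a x => R a x)
    (m : ((Z →L[ℝ] ℝ) →L[ℝ] ℝ) → D → D)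
    (hm : ∀ (F : (Z →L[ℝ] ℝ) →L[ℝ] ℝ) (f : D) (x : E) (μ : Z →L[ℝ] ℝ),
      (∀ T : Z, μ T = P f (R T x)) → P (m F f) x = F μ) {q : DD} (hq : 0 ≤ q)
    (hcont : ∀ f, Continuous fun F : WeakDual ℝ (Z →L[ℝ] ℝ) =>
      Q q (m (WeakDual.toStrongDual F) f)) :
    IsOrderContinuousFun fun f => Q q f := by
  intro s hne hdir hs ε hε
  suffices ∃ x ∈ s, Q q x < ε by
    obtain ⟨x, hx, hxε⟩ := this
    refine ⟨x, hx, fun y hy hyx => ?_⟩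
    rw [abs_of_nonneg (hQ.apply_nonneg hq (hs.1 hy))]
    exact (hQ.mono_right hq hyx).trans_lt hxε
  by_contra! hge
  obtain ⟨f, hf⟩ := hne
  have hf0 : 0 ≤ f := hs.1 hf
  obtain ⟨ν, hν⟩ := hZ.exists_functional hP hf0
  have hmν : ∀ F x, P (m F f) x = F (ν x) := fun F x => hm F f x (ν x) (hν x)
  let K : {g // g ∈ s ∧ g ≤ f} → Set (WeakDual ℝ (Z →L[ℝ] ℝ)) := fun g =>
    WeakDual.toStrongDual ⁻¹' Metric.closedBall 0 1 ∩
      ({F | ∀ x, 0 ≤ x → F (ν x) ∈ Set.Icc 0 (P g x)} ∩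
        {F | ε ≤ Q q (m (WeakDual.toStrongDual F) f)})
  have hclosed : ∀ g, IsClosed ({F : WeakDual ℝ (Z →L[ℝ] ℝ) | ∀ x, 0 ≤ x →
      F (ν x) ∈ Set.Icc 0 (P (g : D) x)} ∩
        {F | ε ≤ Q q (m (WeakDual.toStrongDual F) f)}) := by
    intro g
    refine IsClosed.inter ?_ (isClosed_le continuous_const (hcont f))
    simp only [Set.ofPred_forall]
    exact isClosed_iInter fun x => isClosed_iInter fun _ =>
      isClosed_Icc.preimage (WeakDual.eval_continuous (ν x))
  have hcompact : ∀ g, IsCompact (K g) := fun g =>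
    (WeakDual.isCompact_closedBall 0 1).inter_right (hclosed g)
  have hnonempty : ∀ g, (K g).Nonempty := by
    rintro ⟨g, hg, hgf⟩
    have hg0 : 0 ≤ g := hs.1 hg
    obtain ⟨F, hF1, hF⟩ := htf.exists_bidual_apply_eq hP hsep hZ hg0 hgf ν hν
    refine ⟨WeakDual.toStrongDual.symm F, ?_, fun x hx => ?_, ?_⟩
    · rw [Set.mem_preimage, LinearEquiv.apply_symm_apply]
      exact (mem_closedBall_zero_iff (E := StrongDual ℝ (Z →L[ℝ] ℝ))).2 hF1
    · exact ⟨(hP.apply_nonneg hg0 hx).trans_eq (hF x).symm, (hF x).le⟩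
    · have : m F f = g := hP.inj _ _ fun x => (hmν F x).trans (hF x)
      exact (hge g hg).trans_eq (congrArg _ this.symm)
  have hdirected : Directed (· ⊇ ·) K := by
    rintro ⟨g, hg, hgf⟩ ⟨h, hh, hhf⟩
    obtain ⟨k, hk, hkg, hkh⟩ := hdir g hg h hh
    refine ⟨⟨k, hk, hkg.trans hgf⟩, fun F hF => ⟨hF.1, fun x hx => ?_, hF.2.2⟩,
      fun F hF => ⟨hF.1, fun x hx => ?_, hF.2.2⟩⟩
    · exact ⟨(hF.2.1 x hx).1, (hF.2.1 x hx).2.trans (hP.mono_left hkg hx)⟩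
    · exact ⟨(hF.2.1 x hx).1, (hF.2.1 x hx).2.trans (hP.mono_left hkh hx)⟩
  have : Nonempty {g // g ∈ s ∧ g ≤ f} := ⟨⟨f, hf, le_rfl⟩⟩
  obtain ⟨F, hF⟩ := IsCompact.nonempty_iInter_of_directed_nonempty_isCompact_isClosed K hdirected
    hnonempty hcompact fun g => (hcompact g).isClosed
  rw [Set.mem_iInter] at hF
  have hmF : m (WeakDual.toStrongDual F) f ≤ 0 := by
    refine hs.2 fun g hg => ?_
    obtain ⟨k, hk, hkf, hkg⟩ := hdir f hf g hg
    refine le_trans ((hP.le_iff _ _).2 fun x hx => ?_) hkg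
    rw [hmν]
    exact ((hF ⟨k, hk, hkf⟩).2.1 x hx).2
  have h1 := hQ.mono_right hq hmF
  have h2 := (hF ⟨f, hf, le_rfl⟩).2.2
  rw [map_zero] at h1
  exact absurd (hε.trans_le (h2.trans h1)) (lt_irrefl 0)

end TopFullCenter

namespace IsOrderDual

variable {E D DD : Type*} [Lattice E] [AddCommGroup E] [Module ℝ E]
  [IsOrderedAddMonoid E] [IsOrderedModule ℝ E]
  [Lattice D] [AddCommGroup D] [Module ℝ D] [IsOrderedAddMonoid D] [IsOrderedModule ℝ D]
  [Lattice DD] [AddCommGroup DD] [Module ℝ DD]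
  {P : D →ₗ[ℝ] E →ₗ[ℝ] ℝ} {Q : DD →ₗ[ℝ] D →ₗ[ℝ] ℝ}

omit [IsOrderedModule ℝ D] in
/-- Among the functionals in `[0, f]` vanishing at `y` there is a largest one. -/
theorem exists_isLUB_null (hP : IsOrderDual E D fun f x => P f x) {f : D} (hf : 0 ≤ f) {y : E}
    (hy : 0 ≤ y) : ∃ n : D, IsLUB {w | 0 ≤ w ∧ w ≤ f ∧ P w y = 0} n ∧ P n y = 0 := by
  have h0 : (0 : D) ∈ {w | 0 ≤ w ∧ w ≤ f ∧ P w y = 0} := ⟨le_rfl, hf, by simp⟩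
  obtain ⟨n, hn, hle⟩ := hP.exists_isLUB (s := {w | 0 ≤ w ∧ w ≤ f ∧ P w y = 0}) (f := f)
    ⟨0, h0⟩ (by
      rintro v ⟨hv0, hvf, hvy⟩ w ⟨hw0, hwf, hwy⟩
      have h0 : 0 ≤ v ⊔ w := hv0.trans le_sup_left
      refine ⟨v ⊔ w, ⟨h0, sup_le hvf hwf, (hP.apply_nonneg h0 hy).antisymm' ?_⟩,
        le_sup_left, le_sup_right⟩
      have h : v ⊔ w ≤ v + w :=
        sup_le (le_add_of_nonneg_right hw0) (le_add_of_nonneg_left hv0)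
      simpa [hvy, hwy] using hP.mono_left h hy) (fun w hw => ⟨hw.1, hw.2.1⟩)
  exact ⟨n, hn, (hle y hy 0 fun w hw => hw.2.2.le).antisymm (hP.apply_nonneg (hn.1 h0) hy)⟩

omit [IsOrderedModule ℝ D] in
/-- A Borel–Cantelli argument: an order continuous functional that stays above `ε` on elements
of `[0, f]` with arbitrarily small value at `y` is at least `ε` at the largest element of `[0, f]`
vanishing at `y`. -/
theorem le_apply_of_isLUB_null (hP : IsOrderDual E D fun f x => P f x)
    (hQ : IsOrderDual D DD fun q f => Q q f) {q : DD} (hq : 0 ≤ q)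
    (hqc : IsOrderContinuousFun fun f => Q q f) {f : D} (hf : 0 ≤ f) {y : E} (hy : 0 ≤ y)
    {ε : ℝ} (hε : ∀ δ : ℝ, 0 < δ → ∃ g, 0 ≤ g ∧ g ≤ f ∧ ε ≤ Q q g ∧ P g y ≤ δ) {n : D}
    (hn : IsLUB {w | 0 ≤ w ∧ w ≤ f ∧ P w y = 0} n) (hny : P n y = 0) : ε ≤ Q q n := by
  have hn0 : 0 ≤ n := hn.1 ⟨le_rfl, hf, by simp⟩
  have hnf : n ≤ f := hn.2 fun w hw => hw.2.1
  choose g hg0 hgf hgε hgy using fun k : ℕ => hε ((1 / 2) ^ k) (by positivity)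
  let S : ℕ → Set D := fun k =>
    {h | 0 ≤ h ∧ h ≤ f ∧ ∃ s : Finset ℕ, (∀ i ∈ s, k ≤ i) ∧ h ≤ ∑ i ∈ s, g i}
  have hS0 : ∀ k, (0 : D) ∈ S k := fun k => ⟨le_rfl, hf, ∅, by simp, by simp⟩
  choose H hH hHle using fun k => hP.exists_isLUB (s := S k) (f := f) ⟨0, hS0 k⟩ (by
    rintro v ⟨hv0, hvf, s, hs, hvs⟩ w ⟨hw0, hwf, t, ht, hwt⟩
    classical
    refine ⟨v ⊔ w, ⟨hv0.trans le_sup_left, sup_le hvf hwf, s ∪ t, fun i hi => ?_, sup_le ?_ ?_⟩,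
        le_sup_left, le_sup_right⟩
    · exact (Finset.mem_union.1 hi).elim (hs i) (ht i)
    · exact hvs.trans (Finset.sum_le_sum_of_subset_of_nonneg Finset.subset_union_left
        fun i _ _ => hg0 i)
    · exact hwt.trans (Finset.sum_le_sum_of_subset_of_nonneg Finset.subset_union_right
        fun i _ _ => hg0 i)) (fun w hw => ⟨hw.1, hw.2.1⟩)
  have hH0 : ∀ k, 0 ≤ H k := fun k => (hH k).1 (hS0 k)
  have hHf : ∀ k, H k ≤ f := fun k => (hH k).2 fun w hw => hw.2.1
  have hgH : ∀ k, g k ≤ H k := fun k => (hH k).1 ⟨hg0 k, hgf k, {k}, by simp, by simp⟩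
  have hanti : Antitone H := fun i j hij => (hH j).2 fun w ⟨hw0, hwf, s, hs, hws⟩ =>
    (hH i).1 ⟨hw0, hwf, s, fun k hk => hij.trans (hs k hk), hws⟩
  have hsmall : ∀ δ : ℝ, 0 < δ → ∃ k, P (H k) y ≤ δ := by
    intro δ hδ
    obtain ⟨s₀, hs₀⟩ := summable_iff_vanishing_norm.1 summable_geometric_two δ hδ
    refine ⟨s₀.sup id + 1, hHle _ y hy δ ?_⟩
    rintro w ⟨-, -, s, hs, hws⟩
    have hdisj : Disjoint s s₀ := Finset.disjoint_left.2 fun i his his₀ =>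
      (hs i his).not_gt (Nat.lt_succ_of_le (Finset.le_sup (f := id) his₀))
    calc P w y ≤ P (∑ i ∈ s, g i) y := hP.mono_left hws hy
      _ = ∑ i ∈ s, P (g i) y := by simp
      _ ≤ ∑ i ∈ s, (1 / 2 : ℝ) ^ i := Finset.sum_le_sum fun i _ => hgy i
      _ ≤ δ := (le_abs_self _).trans (hs₀ s hdisj).le
  refine le_of_forall_pos_le_add fun η hη => ?_
  obtain ⟨_, ⟨k, rfl⟩, hk⟩ := hqc (Set.range fun k => (H k - n)⁺) (Set.range_nonempty _) (by
      rintro _ ⟨i, rfl⟩ _ ⟨j, rfl⟩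
      exact ⟨_, ⟨max i j, rfl⟩, posPart_mono (sub_le_sub_right (hanti (le_max_left i j)) n),
        posPart_mono (sub_le_sub_right (hanti (le_max_right i j)) n)⟩)
    (by
      refine ⟨?_, fun l hl => ?_⟩
      · rintro _ ⟨i, rfl⟩
        exact posPart_nonneg _
      have hl' : ∀ k, l⁺ ≤ (H k - n)⁺ := fun k => sup_le (hl ⟨k, rfl⟩) (posPart_nonneg _)
      have hl0 : 0 ≤ l⁺ := posPart_nonneg l
      have hly : P l⁺ y = 0 := by
        refine (le_of_forall_pos_le_add fun δ hδ => ?_).antisymm (hP.apply_nonneg hl0 hy)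
        obtain ⟨k, hk⟩ := hsmall δ hδ
        rw [zero_add]
        exact (hP.mono_left ((hl' k).trans (sup_le (sub_le_self _ hn0) (hH0 k))) hy).trans hk
      have hln : l⁺ + n ≤ n := hn.1 ⟨add_nonneg hl0 hn0, by
        refine (add_le_add_left (hl' 0) n).trans ?_
        rw [posPart_def, sup_add, sub_add_cancel, zero_add]
        exact sup_le (hHf 0) hnf, by simp [hly, hny]⟩
      exact (le_posPart l).trans (by simpa using hln)) η hη
  have hk := (le_abs_self _).trans_lt (hk _ ⟨k, rfl⟩ le_rfl)
  have hgk := hQ.mono_right hq ((hgH k).trans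
    (sub_le_iff_le_add.1 (le_posPart (H k - n))))
  rw [map_add] at hgk
  have := hgε k
  simp only at hk
  linarith

/-- An order continuous functional on the order dual is approximated, in the absolute weak
sense, from below by evaluations at elements of the original space. -/
theorem exists_eval_posPart_le (hP : IsOrderDual E D fun f x => P f x)
    (hQ : IsOrderDual D DD fun q f => Q q f) {q : DD} (hq : 0 ≤ q)
    (hqc : IsOrderContinuousFun fun f => Q q f) {f : D} (hf : 0 ≤ f) {ε : ℝ} (hε : 0 < ε) :
    ∃ y, 0 ≤ y ∧ ∃ e : DD, 0 ≤ e ∧ (∀ g, Q e g = P g y) ∧ Q (q - e)⁺ f ≤ ε := by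
  by_contra! hcon
  have hlarge : ∀ y, 0 ≤ y → ∃ g, 0 ≤ g ∧ g ≤ f ∧ ε < Q q g - P g y := by
    intro y hy
    obtain ⟨e, he0, he⟩ := hQ.exists_of_nonneg (P.flip y) fun g hg => hP.apply_nonneg hg hy
    by_contra! hle
    refine (hcon y hy e he0 he).not_ge (hQ.posPart_apply_le _ hf fun g hg0 hgf => ?_)
    rw [map_sub, LinearMap.sub_apply, he]
    exact hle g hg0 hgf
  have hsmall : ∀ y, 0 ≤ y → ∀ δ : ℝ, 0 < δ →
      ∃ g, 0 ≤ g ∧ g ≤ f ∧ ε ≤ Q q g ∧ P g y ≤ δ := by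
    intro y hy δ hδ
    have hqf := hQ.apply_nonneg hq hf
    have hc : 0 < (Q q f + 1) / δ := by positivity
    obtain ⟨g, hg0, hgf, hg⟩ := hlarge (((Q q f + 1) / δ) • y) (smul_nonneg hc.le hy)
    have h1 := hQ.mono_right hq hgf
    have h2 := hP.apply_nonneg hg0 hy
    rw [map_smul, smul_eq_mul] at hg
    have h3 := mul_nonneg hc.le h2
    refine ⟨g, hg0, hgf, by linarith, ?_⟩
    by_contra! hlt
    have h4 : Q q f + 1 < (Q q f + 1) / δ * P g y := by
      rw [div_mul_eq_mul_div, lt_div_iff₀ hδ]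
      exact mul_lt_mul_of_pos_left hlt (by positivity)
    linarith
  choose! N hN hNy using fun y (hy : 0 ≤ y) => hP.exists_isLUB_null hf hy
  have hN0 : ∀ y, 0 ≤ y → 0 ≤ N y := fun y hy => (hN y hy).1 ⟨le_rfl, hf, by simp⟩
  have hmono : ∀ y z, 0 ≤ y → y ≤ z → N z ≤ N y := fun y z hy hyz =>
    (hN z (hy.trans hyz)).2 fun w ⟨hw0, hwf, hwz⟩ => (hN y hy).1 ⟨hw0, hwf,
      ((hP.mono_right hw0 hyz).trans_eq hwz).antisymm (hP.apply_nonneg hw0 hy)⟩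
  obtain ⟨_, ⟨y, hy, rfl⟩, hlt⟩ := hqc (N '' {y | 0 ≤ y}) ⟨_, 0, le_refl (0 : E), rfl⟩ (by
      rintro _ ⟨y, hy, rfl⟩ _ ⟨z, hz, rfl⟩
      exact ⟨_, ⟨y + z, add_nonneg hy hz, rfl⟩, hmono _ _ hy (le_add_of_nonneg_right hz),
        hmono _ _ hz (le_add_of_nonneg_left hy)⟩)
    (by
      refine ⟨?_, fun l hl => (le_posPart l).trans ((hP.le_iff _ _).2 fun y hy => ?_)⟩
      · rintro _ ⟨y, hy, rfl⟩
        exact hN0 y hy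
      have hle : l⁺ ≤ N y := sup_le (hl ⟨y, hy, rfl⟩) (hN0 y hy)
      simpa [hNy y hy] using hP.mono_left hle hy)
    ε hε
  have h := hP.le_apply_of_isLUB_null hQ hq hqc hf hy (hsmall y hy) (hN y hy) (hNy y hy)
  exact ((le_abs_self _).trans_lt (hlt _ ⟨y, hy, rfl⟩ le_rfl)).not_ge h

end IsOrderDual

namespace IsCenterOf

variable {E D DD Z : Type*} [Lattice E] [AddCommGroup E] [Module ℝ E]
  [Lattice D] [AddCommGroup D] [Module ℝ D]
  [Lattice DD] [AddCommGroup DD] [Module ℝ DD]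
  [Lattice Z] [NormedRing Z] [NormedAlgebra ℝ Z] [IsOrderedAddMonoid Z]
  {P : D →ₗ[ℝ] E →ₗ[ℝ] ℝ} {Q : DD →ₗ[ℝ] D →ₗ[ℝ] ℝ} {R : Z →ₗ[ℝ] E →ₗ[ℝ] E}
  {A : Z →ₗ[ℝ] D →ₗ[ℝ] D}

/-- The positive functional `T ↦ q (f ∘ T)` on the center. -/
theorem exists_bidual_functional (hZ : IsCenterOf E Z fun a x => R a x)
    (hP : IsOrderDual E D fun f x => P f x) (hQ : IsOrderDual D DD fun q f => Q q f)
    (hA : ∀ T f x, P (A T f) x = P f (R T x)) {q : DD} (hq : 0 ≤ q) {f : D} (hf : 0 ≤ f) :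
    ∃ κ : Z →L[ℝ] ℝ, (∀ T, κ T = Q q (A T f)) ∧ dualNonneg κ ∧ ‖κ‖ ≤ Q q f := by
  have hA0 : ∀ T, 0 ≤ T → 0 ≤ A T f := fun T hT => hP.nonneg_iff.2 fun x hx => by
    rw [hA]
    exact hP.apply_nonneg hf (hZ.nonneg_iff.1 hT x hx)
  have hA1 : A 1 f = f := hP.inj _ _ fun x => by
    rw [hA, hZ.map_one_apply]
  have hκ := hZ.abs_le_of_dualNonneg (Q q ∘ₗ A.flip f) fun T hT => hQ.apply_nonneg hq (hA0 T hT)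
  refine ⟨(Q q ∘ₗ A.flip f).mkContinuous _ hκ, fun T => rfl,
    fun T hT => hQ.apply_nonneg hq (hA0 T hT), ?_⟩
  have h := LinearMap.mkContinuous_norm_le (Q q ∘ₗ A.flip f)
    (by simpa [hA1] using hQ.apply_nonneg hq hf) hκ
  simpa only [LinearMap.comp_apply, LinearMap.flip_apply, hA1] using h

variable [IsOrderedAddMonoid E] [IsOrderedModule ℝ E] [IsOrderedAddMonoid D]
  [IsOrderedModule ℝ D] [IsOrderedAddMonoid DD] [IsOrderedModule ℝ Z]

/-- An order continuous `q` intertwines the Arens homomorphism with the bidual of the center. -/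
theorem apply_eq_of_isOrderContinuousFun (hZ : IsCenterOf E Z fun a x => R a x)
    (hP : IsOrderDual E D fun f x => P f x) (hQ : IsOrderDual D DD fun q f => Q q f)
    (hA : ∀ T f x, P (A T f) x = P f (R T x)) {q : DD} (hq : 0 ≤ q)
    (hqc : IsOrderContinuousFun fun f => Q q f) {f : D} (hf : 0 ≤ f)
    (F : (Z →L[ℝ] ℝ) →L[ℝ] ℝ) {g : D}
    (hg : ∀ (x : E) (μ : Z →L[ℝ] ℝ), (∀ T : Z, μ T = P f (R T x)) → P g x = F μ)
    {κ : Z →L[ℝ] ℝ} (hκ : ∀ T, κ T = Q q (A T f)) : Q q g = F κ := by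
  have heval : ∀ u : E, 0 ≤ u → ∃ e : DD, 0 ≤ e ∧ ∀ h, Q e h = P h u := fun u hu =>
    hQ.exists_of_nonneg (P.flip u) fun h hh => hP.apply_nonneg hh hu
  have hgle : ∀ u, 0 ≤ u → |P g u| ≤ ‖F‖ * P f u := by
    intro u hu
    obtain ⟨e, he0, he⟩ := heval u hu
    obtain ⟨μ, hμ, -, hμn⟩ := hZ.exists_bidual_functional hP hQ hA he0 hf
    rw [hg u μ fun T => by rw [hμ, he, hA], ← he f]
    exact (F.le_opNorm μ).trans (by gcongr)
  suffices h : ∀ ε : ℝ, 0 < ε → |Q q g - F κ| ≤ (2 * ‖F‖ + 2) * ε by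
    refine sub_eq_zero.1 (abs_nonpos_iff.1 (le_of_forall_pos_le_add fun δ hδ => ?_))
    have h := h (δ / (2 * ‖F‖ + 2)) (by positivity)
    rwa [mul_div_cancel₀ _ (by positivity : 2 * ‖F‖ + 2 ≠ 0), ← zero_add δ] at h
  intro ε hε
  obtain ⟨y, hy, e, he0, he, hzε⟩ := hP.exists_eval_posPart_le hQ hq hqc hf hε
  set z := (q - e)⁺ with hz
  have hz0 : 0 ≤ z := posPart_nonneg _
  have hp : q - z = q ⊓ e := by rw [hz, posPart_sub_eq_sub_inf, sub_sub_cancel]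
  set p := q - z with hpdef
  have hp0 : 0 ≤ p := hp ▸ le_inf hq he0
  have hpe : p ≤ e := hp ▸ inf_le_right
  have hq_eq : ∀ h, Q q h = Q z h + Q p h := fun h => by
    rw [hpdef, map_sub, LinearMap.sub_apply, add_sub_cancel]
  have hA0 : ∀ T, 0 ≤ T → 0 ≤ A T f := fun T hT => hP.nonneg_iff.2 fun x hx => by
    rw [hA]
    exact hP.apply_nonneg hf (hZ.nonneg_iff.1 hT x hx)
  obtain ⟨κz, hκz, -, hκzn⟩ := hZ.exists_bidual_functional hP hQ hA hz0 hf
  obtain ⟨κp, hκp, hκp0, -⟩ := hZ.exists_bidual_functional hP hQ hA hp0 hf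
  obtain ⟨κe, hκe, hκe0, -⟩ := hZ.exists_bidual_functional hP hQ hA he0 hf
  have hκ_eq : κ = κz + κp := by
    ext T
    rw [add_apply, hκ, hκz, hκp, hq_eq]
  obtain ⟨S, hS⟩ := hZ.exists_uniform_approx κe hκe0 F hε
  have h1 : |F κz| ≤ ‖F‖ * ε := (F.le_opNorm κz).trans (by gcongr; exact hκzn.trans hzε)
  have h2 : |F κp - κp S| ≤ ε := hS κp hκp0 fun a ha => by
    rw [hκp, hκe]
    exact hQ.mono_left hpe (hA0 a ha)
  have h3 : |Q z g| ≤ ‖F‖ * ε := by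
    have hle : g ≤ ‖F‖ • f := (hP.le_iff _ _).2 fun x hx => by
      simpa using (abs_le.1 (hgle x hx)).2
    have hge : -(‖F‖ • f) ≤ g := (hP.le_iff _ _).2 fun x hx => by
      simpa using (abs_le.1 (hgle x hx)).1
    have hle := hQ.mono_right hz0 hle
    have hge := hQ.mono_right hz0 hge
    rw [map_neg, map_smul, smul_eq_mul] at hge
    rw [map_smul, smul_eq_mul] at hle
    exact (abs_le.2 ⟨hge, hle⟩).trans (by gcongr)
  have h4 : |Q p (g - A S f)| ≤ ε := by
    obtain ⟨hpos, hneg⟩ := hP.abs_apply_le_of_le (g - A S f) hy (c := ε) fun u hu0 huy => by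
      obtain ⟨d, hd0, hd⟩ := heval u hu0
      obtain ⟨μ, hμ, hμ0, -⟩ := hZ.exists_bidual_functional hP hQ hA hd0 hf
      rw [map_sub, LinearMap.sub_apply, hg u μ fun T => by rw [hμ, hd, hA], ← hd, ← hμ]
      refine hS μ hμ0 fun a ha => ?_
      rw [hμ, hκe, hd, he]
      exact hP.mono_right (hA0 a ha) huy
    rw [← he] at hpos hneg
    have hpos' := hQ.mono_left hpe (posPart_nonneg (g - A S f))
    have hneg' := hQ.mono_left hpe (negPart_nonneg (g - A S f))
    have hpos0 := hQ.apply_nonneg hp0 (posPart_nonneg (g - A S f))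
    have hneg0 := hQ.apply_nonneg hp0 (negPart_nonneg (g - A S f))
    rw [← posPart_sub_negPart (g - A S f), map_sub, abs_le]
    constructor <;> linarith
  rw [map_sub, ← hκp] at h4
  rw [hκ_eq, map_add, hq_eq]
  rw [abs_le] at *
  constructor <;> linarith [h1.1, h1.2, h2.1, h2.2, h3.1, h3.2, h4.1, h4.2]

end IsCenterOf

/-- Continuity from the weak* topology to the operator topology, tested pointwise. -/
theorem continuous_operatorTopology_iff {V D DD : Type*} [NormedAddCommGroup V]
    [NormedSpace ℝ V] (p : DD → D → ℝ) (m : (V →L[ℝ] ℝ) → D → D) :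
    @Continuous _ _
      (TopologicalSpace.induced (fun F : V →L[ℝ] ℝ => fun μ : V => F μ) Pi.topologicalSpace)
      (TopologicalSpace.induced
        (fun S : D → D => fun q : D × DD => p q.2 (S q.1)) Pi.topologicalSpace) m ↔
      ∀ q f, Continuous fun F : WeakDual ℝ V => p q (m (WeakDual.toStrongDual F) f) := by
  rw [@continuous_induced_rng, @continuous_pi_iff, Prod.forall, forall_comm]
  rfl

/-- Corollary 5.  Let `E` be a Riesz space with point separating order
dual (realized as `D`, with order bidual `E^{∼∼}` realized as `DD`) and topologically
full center.  The following are equivalent: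
(1) `E^{∼∼} = (E^∼)ₙ^∼`, i.e. every order bounded functional on `E^∼` is order continuous;
(2) the Arens homomorphism `m : Z(E)'' → Z(E^∼)` is continuous from the
`σ(Z(E)'',Z(E)')`-topology to the `σ(E^∼,E^{∼∼})`-operator topology (the topology of
pointwise `σ(E^∼,E^{∼∼})`-convergence on `E^∼`). -/
theorem statement14
    {E D DD Z : Type*}
    [Lattice E] [AddCommGroup E] [Module ℝ E]
    [CovariantClass E E (· + ·) (· ≤ ·)] [PosSMulMono ℝ E]
    [Lattice D] [AddCommGroup D] [Module ℝ D]
    [CovariantClass D D (· + ·) (· ≤ ·)] [PosSMulMono ℝ D]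
    [Lattice DD] [AddCommGroup DD] [Module ℝ DD]
    [CovariantClass DD DD (· + ·) (· ≤ ·)] [PosSMulMono ℝ DD]
    [Lattice Z] [NormedRing Z] [NormedAlgebra ℝ Z]
    [CovariantClass Z Z (· + ·) (· ≤ ·)] [PosSMulMono ℝ Z]
    (pE : D → E → ℝ) (hD : IsOrderDual E D pE) (hsep : SepPoints pE)
    -- `DD` realizes the order bidual `E^{∼∼} = (E^∼)^∼`:
    (pD : DD → D → ℝ) (hDD : IsOrderDual D DD pD)
    (ρ : Z → E → E) (hZ : IsCenterOf E Z ρ)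
    -- `E` has a topologically full center:
    (htf : TopFullCenter pE ρ)
    -- the Arens homomorphism `m : Z(E)'' → Z(E^∼)`:
    (m : ((Z →L[ℝ] ℝ) →L[ℝ] ℝ) → D → D)
    (hm : ∀ (F : (Z →L[ℝ] ℝ) →L[ℝ] ℝ) (f : D) (x : E) (μ : Z →L[ℝ] ℝ),
      (∀ T : Z, μ T = pE f (ρ T x)) → pE (m F f) x = F μ) :
    -- (1) every order bounded functional on `E^∼` is order continuous
    (∀ x'' : DD, IsOrderContinuousFun (pD x'')) ↔
    -- (2) `m` is `σ(Z'',Z')`-to-`σ(E^∼,E^{∼∼})`-operator-topology continuous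
    @Continuous _ _
      (TopologicalSpace.induced
        (fun F : (Z →L[ℝ] ℝ) →L[ℝ] ℝ => fun μ : Z →L[ℝ] ℝ => F μ) Pi.topologicalSpace)
      (TopologicalSpace.induced
        (fun S : D → D => fun q : D × DD => pD q.2 (S q.1)) Pi.topologicalSpace)
      m := by
  have : IsOrderedAddMonoid E := { add_le_add_left := fun a b h c => by exact add_le_add_left h c }
  have : IsOrderedAddMonoid D := { add_le_add_left := fun a b h c => by exact add_le_add_left h c }
  have : IsOrderedAddMonoid DD :=
    { add_le_add_left := fun a b h c => by exact add_le_add_left h c }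
  have : IsOrderedAddMonoid Z := { add_le_add_left := fun a b h c => by exact add_le_add_left h c }
  have : IsOrderedModule ℝ E := .of_smul_nonneg fun c hc x hx => smul_nonneg hc hx
  have : IsOrderedModule ℝ D := .of_smul_nonneg fun c hc x hx => smul_nonneg hc hx
  have : IsOrderedModule ℝ Z := .of_smul_nonneg fun c hc x hx => smul_nonneg hc hx
  obtain ⟨P, rfl⟩ : ∃ P : D →ₗ[ℝ] E →ₗ[ℝ] ℝ, pE = fun f x => P f x :=
    ⟨LinearMap.mk₂ ℝ pE (fun f g x => (hD.lin_vec x).map_add f g)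
      (fun c f x => (hD.lin_vec x).map_smul c f) (fun f => (hD.lin_fun f).map_add)
      (fun c f => (hD.lin_fun f).map_smul c), rfl⟩
  obtain ⟨Q, rfl⟩ : ∃ Q : DD →ₗ[ℝ] D →ₗ[ℝ] ℝ, pD = fun q f => Q q f :=
    ⟨LinearMap.mk₂ ℝ pD (fun f g x => (hDD.lin_vec x).map_add f g)
      (fun c f x => (hDD.lin_vec x).map_smul c f) (fun f => (hDD.lin_fun f).map_add)
      (fun c f => (hDD.lin_fun f).map_smul c), rfl⟩
  obtain ⟨R, rfl⟩ : ∃ R : Z →ₗ[ℝ] E →ₗ[ℝ] E, ρ = fun a x => R a x :=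
    ⟨LinearMap.mk₂ ℝ ρ (fun f g x => (hZ.lin_vec x).map_add f g)
      (fun c f x => (hZ.lin_vec x).map_smul c f) (fun a => (hZ.central a).1.1.map_add)
      (fun c a => (hZ.central a).1.1.map_smul c), rfl⟩
  beta_reduce at hm ⊢
  refine Iff.trans ?_ (continuous_operatorTopology_iff (fun q f => Q q f) m).symm
  constructor
  · intro h
    obtain ⟨A, hA⟩ := hZ.exists_adjoint hD
    intro q f
    suffices ∃ κ : Z →L[ℝ] ℝ, ∀ F, Q q (m F f) = F κ by
      obtain ⟨κ, hκ⟩ := this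
      exact (WeakDual.eval_continuous κ).congr fun F => (hκ _).symm
    have hm_sub : ∀ F, m F f = m F f⁺ - m F f⁻ := by
      intro F
      refine hD.inj _ _ fun x => ?_
      obtain ⟨ν₁, hν₁⟩ := hZ.exists_functional hD (posPart_nonneg f)
      obtain ⟨ν₂, hν₂⟩ := hZ.exists_functional hD (negPart_nonneg f)
      have hx := hm F f x (ν₁ x - ν₂ x) fun T => by
        rw [sub_apply, hν₁, hν₂, ← LinearMap.sub_apply, ← map_sub, posPart_sub_negPart]
      rw [hx, map_sub, map_sub, LinearMap.sub_apply, hm F f⁺ x _ (hν₁ x), hm F f⁻ x _ (hν₂ x)]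
    have key : ∀ (q' : DD) (f' : D), 0 ≤ q' → 0 ≤ f' →
        ∃ κ : Z →L[ℝ] ℝ, ∀ F, Q q' (m F f') = F κ := by
      intro q' f' hq' hf'
      obtain ⟨κ, hκ, -⟩ := hZ.exists_bidual_functional hD hDD hA hq' hf'
      exact ⟨κ, fun F => hZ.apply_eq_of_isOrderContinuousFun hD hDD hA hq' (h q') hf' F
        (hm F f') hκ⟩
    obtain ⟨κ₁, h₁⟩ := key q⁺ f⁺ (posPart_nonneg q) (posPart_nonneg f)
    obtain ⟨κ₂, h₂⟩ := key q⁺ f⁻ (posPart_nonneg q) (negPart_nonneg f)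
    obtain ⟨κ₃, h₃⟩ := key q⁻ f⁺ (negPart_nonneg q) (posPart_nonneg f)
    obtain ⟨κ₄, h₄⟩ := key q⁻ f⁻ (negPart_nonneg q) (negPart_nonneg f)
    refine ⟨κ₁ - κ₂ - (κ₃ - κ₄), fun F => ?_⟩
    rw [hm_sub, ← posPart_sub_negPart q]
    simp only [map_sub, LinearMap.sub_apply, h₁, h₂, h₃, h₄]
    ring
  · intro h q
    have key : ∀ q : DD, 0 ≤ q → IsOrderContinuousFun fun f => Q q f := fun q hq =>
      htf.isOrderContinuousFun_of_continuous hD hsep hDD hZ m hm hq (h q)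
    have hq := (key q⁺ (posPart_nonneg q)).sub (key q⁻ (negPart_nonneg q))
    simpa only [← LinearMap.sub_apply, ← map_sub, posPart_sub_negPart] using hq
end
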